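/- arXiv:2108.11132 — 2 statements merged into one kernel-verified Lean document; each statement's English description precedes it below -/
import Mathlib

section
/- Let P ⊂ ℝ^d be a lattice polytope that is not centrally symmetric. Then there exists a nonempty open subset U of aff_0(P) (open in the subspace topology of aff_0(P)) such that for every translation vector c ∈ U, the translated lattice point enumerators satisfy L_{(P,c)} ≠ L_{(P,−c)}, i.e., there is a positive integer t with #((c + tP) ∩ ℤ^d) ≠ #((−c + tP) ∩ ℤ^d). -/
open Pointwise MeasureTheory
open scoped RealInnerProductSpace

noncomputable section

/-- Cast an integer vector to a real vector. -/
def castVec {d : ℕ} (x : Fin d → ℤ) : Fin d → ℝ := fun i => (x i : ℝ)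

/-- Cast a rational vector to a real vector. -/
def ratVec {d : ℕ} (c : Fin d → ℚ) : Fin d → ℝ := fun i => (c i : ℝ)

/-- `den(c)`: the lcm of the denominators of the coordinates of a rational vector. -/
def denv {d : ℕ} (c : Fin d → ℚ) : ℕ := Finset.univ.lcm fun i => (c i).den

/-- The number of lattice points in a subset of `ℝ^d`. -/
def latCount {d : ℕ} (S : Set (Fin d → ℝ)) : ℕ := {x : Fin d → ℤ | castVec x ∈ S}.ncard

/-- A lattice polytope: the convex hull of a nonempty finite set of integer points. -/
def IsLatticePolytope {d : ℕ} (P : Set (Fin d → ℝ)) : Prop :=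
  ∃ V : Finset (Fin d → ℤ), V.Nonempty ∧ P = convexHull ℝ (castVec '' (V : Set (Fin d → ℤ)))

/-- The zonotope spanned by a finite set of integer vectors. -/
def zonotopeF {d : ℕ} (U : Finset (Fin d → ℤ)) : Set (Fin d → ℝ) :=
  {x | ∃ lam : (Fin d → ℤ) → ℝ, (∀ u, lam u ∈ Set.Icc (0 : ℝ) 1) ∧
    x = ∑ u ∈ U, lam u • castVec u}

/-- The zonotope spanned by integer vectors `u 0, …, u (n-1)`. -/
def zonotopeZ {d n : ℕ} (u : Fin n → Fin d → ℤ) : Set (Fin d → ℝ) :=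
  {x | ∃ lam : Fin n → ℝ, (∀ i, lam i ∈ Set.Icc (0 : ℝ) 1) ∧ x = ∑ i, lam i • castVec (u i)}

/-- The zonotope spanned by real vectors `u 0, …, u (n-1)`. -/
def zonotopeR {d n : ℕ} (u : Fin n → Fin d → ℝ) : Set (Fin d → ℝ) :=
  {x | ∃ lam : Fin n → ℝ, (∀ i, lam i ∈ Set.Icc (0 : ℝ) 1) ∧ x = ∑ i, lam i • u i}

/-- A zonotope: a translate of the Minkowski sum of finitely many segments `[0, uᵢ]`. -/
def IsZonotope {d : ℕ} (P : Set (Fin d → ℝ)) : Prop :=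
  ∃ (n : ℕ) (u : Fin n → Fin d → ℝ) (v : Fin d → ℝ), P = v +ᵥ zonotopeR u

/-- A set is centrally symmetric if it is a translate of its negation. -/
def CentrallySymmetric {d : ℕ} (P : Set (Fin d → ℝ)) : Prop :=
  ∃ v : Fin d → ℝ, P = v +ᵥ (-P)

/-- `f` is a family of constituents of `L` with respect to the period `ρ`. -/
def IsConstituents (L : ℕ → ℚ) (ρ : ℕ) (f : ℕ → Polynomial ℚ) : Prop :=
  ∀ t : ℕ, 0 < t → L t = (f (t % ρ)).eval (t : ℚ)

/-- `ρ` is a period of the quasi-polynomial `L`. -/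
def IsPeriodOf (ρ : ℕ) (L : ℕ → ℚ) : Prop := 0 < ρ ∧ ∃ f, IsConstituents L ρ f

/-- `ρ₀` is the minimal period of the quasi-polynomial `L`. -/
def IsMinimalPeriodOf (ρ₀ : ℕ) (L : ℕ → ℚ) : Prop :=
  IsPeriodOf ρ₀ L ∧ ∀ ρ : ℕ, IsPeriodOf ρ L → ρ₀ ≤ ρ

/-- GCD-property with respect to the period `ρ`: constituents with equal
`gcd(ρ, ·)` coincide. -/
def GCDProperty (L : ℕ → ℚ) (ρ : ℕ) : Prop :=
  ∀ f : ℕ → Polynomial ℚ, IsConstituents L ρ f →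
    ∀ k ℓ : ℕ, Nat.gcd ρ k = Nat.gcd ρ ℓ → f (k % ρ) = f (ℓ % ρ)

/-- Symmetry with respect to the period `ρ`: `f_k = f_{ρ-k}` for `0 ≤ k ≤ ρ`. -/
def SymmetricQP (L : ℕ → ℚ) (ρ : ℕ) : Prop :=
  ∀ f : ℕ → Polynomial ℚ, IsConstituents L ρ f →
    ∀ k : ℕ, k ≤ ρ → f (k % ρ) = f ((ρ - k) % ρ)

/-- The Ehrhart counting function `t ↦ #(t(c + P) ∩ ℤ^d)` of the translate `c + P`. -/
def ehr {d : ℕ} (P : Set (Fin d → ℝ)) (c : Fin d → ℚ) : ℕ → ℚ :=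
  fun t => (latCount ((t : ℝ) • (ratVec c +ᵥ P)) : ℚ)

/-- The dimension of a polytope: the dimension of the direction of its affine hull. -/
def polyDim {d : ℕ} (P : Set (Fin d → ℝ)) : ℕ := Module.finrank ℝ (affineSpan ℝ P).direction

/-- `r` is the relative volume of `P` (of dimension `m`): with respect to any lattice
point `v₀` of `P` and any `ℤ`-basis `b` of the lattice `aff₀(P) ∩ ℤ^d`, `r` is the
Lebesgue measure of `P` in the coordinates determined by `v₀` and `b`. -/
def IsRelVolOf {d : ℕ} (P : Set (Fin d → ℝ)) (m : ℕ) (r : ℝ) : Prop :=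
  ∀ (v₀ : Fin d → ℤ) (b : Fin m → Fin d → ℤ),
    castVec v₀ ∈ P → LinearIndependent ℤ b →
    (∀ x : Fin d → ℤ,
      castVec x ∈ (affineSpan ℝ P).direction ↔ x ∈ Submodule.span ℤ (Set.range b)) →
    r = (volume {lam : Fin m → ℝ | castVec v₀ + ∑ i, lam i • castVec (b i) ∈ P}).toReal

/-- The (real casts of the) elements of `W` are linearly independent over `ℝ`. -/
def LinIndepF {d : ℕ} (W : Finset (Fin d → ℤ)) : Prop :=
  LinearIndependent ℝ fun w : ↥W => castVec w.1

/-- Almost locally constant: locally constant outside a discrete point set. -/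
def AlmostLocallyConstant (f : ℝ → ℝ) : Prop :=
  ∃ D : Set ℝ, DiscreteTopology D ∧ IsLocallyConstant fun x : ↥(Dᶜ) => f ↑x

/-- Almost constant: constant outside a discrete point set. -/
def AlmostConstant (f : ℝ → ℝ) : Prop :=
  ∃ D : Set ℝ, DiscreteTopology D ∧ ∃ r : ℝ, ∀ x ∉ D, f x = r

/-- The face of `P` in the outer normal direction `v`. -/
def normalFace {d : ℕ} (P : Set (EuclideanSpace ℝ (Fin d)))
    (v : EuclideanSpace ℝ (Fin d)) : Set (EuclideanSpace ℝ (Fin d)) :=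
  {x | x ∈ P ∧ ∀ y ∈ P, ⟪y, v⟫ ≤ ⟪x, v⟫}

/-- `F` is a facet of the `d`-polytope `P`: an exposed face of dimension `d - 1`. -/
def IsFacetOf {d : ℕ} (F P : Set (EuclideanSpace ℝ (Fin d))) : Prop :=
  (∃ v : EuclideanSpace ℝ (Fin d), v ≠ 0 ∧ F = normalFace P v) ∧
  Module.finrank ℝ (affineSpan ℝ F).direction = d - 1
open Set Filter Topology
open scoped ENNReal NNReal

section PrekopaLeindler

lemma ENNReal.rpow_mul_rpow_le_weighted {p q : ℝ} (hp : 0 < p) (hq : 0 < q) (hpq : p + q = 1)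
    (a b : ℝ≥0∞) : a ^ p * b ^ q ≤ ENNReal.ofReal p * a + ENNReal.ofReal q * b := by
  rcases eq_or_ne a ∞ with rfl | ha
  · simp [ENNReal.mul_top, hp]
  rcases eq_or_ne b ∞ with rfl | hb
  · simp [ENNReal.mul_top, hq]
  lift a to ℝ≥0 using ha
  lift b to ℝ≥0 using hb
  have h := NNReal.geom_mean_le_arith_mean2_weighted p.toNNReal q.toNNReal a b
    (by rw [← Real.toNNReal_add hp.le hq.le, hpq, Real.toNNReal_one])
  rw [Real.coe_toNNReal p hp.le, Real.coe_toNNReal q hq.le] at h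
  rw [← ENNReal.coe_rpow_of_nonneg _ hp.le, ← ENNReal.coe_rpow_of_nonneg _ hq.le,
    ENNReal.ofReal, ENNReal.ofReal]
  exact_mod_cast h

lemma volume_add_volume_le_of_isCompact {A B : Set ℝ} (hA : IsCompact A) (hB : IsCompact B)
    (hA0 : A.Nonempty) (hB0 : B.Nonempty) : volume A + volume B ≤ volume (A + B) := by
  obtain ⟨a, ha, haA⟩ := hA.exists_isGreatest hA0
  obtain ⟨b, hb, hbB⟩ := hB.exists_isLeast hB0
  have h1 : volume A = volume ((fun x => x + b) '' A) := by
    rw [Set.image_add_right, measure_preimage_add_right]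
  have h2 : volume B = volume ((fun x => a + x) '' B) := by
    rw [Set.image_add_left, measure_preimage_add]
  have hsub : ((fun x => x + b) '' A) ∪ ((fun x => a + x) '' B) ⊆ A + B := by
    rintro x (⟨y, hy, rfl⟩ | ⟨y, hy, rfl⟩)
    · exact Set.add_mem_add hy hb
    · exact Set.add_mem_add ha hy
  have hinter : volume (((fun x => x + b) '' A) ∩ ((fun x => a + x) '' B)) = 0 := by
    refine measure_mono_null (t := {a + b}) ?_ (by simp)
    rintro x ⟨⟨y, hy, rfl⟩, ⟨z, hz, hzx⟩⟩
    have h3 := haA hy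
    have h4 := hbB hz
    simp only at hzx
    simp only [Set.mem_singleton_iff]
    linarith
  have hm : MeasurableSet ((fun x => a + x) '' B) :=
    (hB.image (by fun_prop)).measurableSet
  have := measure_union_add_inter (μ := volume) ((fun x => x + b) '' A) hm
  rw [hinter, add_zero] at this
  rw [h1, h2, ← this]
  exact measure_mono hsub

lemma volume_add_volume_le {A B : Set ℝ} (hA : MeasurableSet A) (hB : MeasurableSet B)
    (hA0 : A.Nonempty) (hB0 : B.Nonempty) : volume A + volume B ≤ volume (A + B) := by
  obtain ⟨a, ha⟩ := hA0
  obtain ⟨b, hb⟩ := hB0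
  have hAB : ∀ K ⊆ A, IsCompact K → ∀ K' ⊆ B, IsCompact K' →
      volume K + volume K' ≤ volume (A + B) := by
    intro K hK hKc K' hK' hKc'
    calc volume K + volume K' ≤ volume (insert a K) + volume (insert b K') := by
          gcongr <;> exact Set.subset_insert _ _
      _ ≤ volume (insert a K + insert b K') :=
          volume_add_volume_le_of_isCompact (hKc.insert a) (hKc'.insert b)
            (Set.insert_nonempty _ _) (Set.insert_nonempty _ _)
      _ ≤ volume (A + B) := measure_mono
          (Set.add_subset_add (Set.insert_subset ha hK) (Set.insert_subset hb hK'))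
  rw [hA.measure_eq_iSup_isCompact, hB.measure_eq_iSup_isCompact]
  simp only [iSup_and']
  refine ENNReal.biSup_add_biSup_le' ⟨∅, by simp⟩ ⟨∅, by simp⟩ ?_
  exact fun K hK K' hK' => hAB K hK.1 hK.2 K' hK'.1 hK'.2

lemma weighted_volume_le {A B C : Set ℝ} {p q : ℝ} (hp : 0 < p) (hq : 0 < q)
    (hA : MeasurableSet A) (hB : MeasurableSet B) (hA0 : A.Nonempty) (hB0 : B.Nonempty)
    (hC : ∀ a ∈ A, ∀ b ∈ B, p * a + q * b ∈ C) :
    ENNReal.ofReal p * volume A + ENNReal.ofReal q * volume B ≤ volume C := by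
  have h1 := volume_add_volume_le (hA.const_smul₀ p) (hB.const_smul₀ q)
    (hA0.smul_set (a := p)) (hB0.smul_set (a := q))
  rw [Measure.addHaar_smul, Measure.addHaar_smul] at h1
  simp only [Module.finrank_self, pow_one, abs_of_pos hp, abs_of_pos hq] at h1
  refine h1.trans (measure_mono ?_)
  rintro x ⟨_, ⟨a, ha, rfl⟩, _, ⟨b, hb, rfl⟩, rfl⟩
  exact hC a ha b hb

lemma lintegral_eq_lintegral_meas_lt_of_le_one {α : Type*} [MeasurableSpace α] (μ : Measure α)
    {u : α → ℝ≥0∞} (hu : Measurable u) (h1 : ∀ x, u x ≤ 1) :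
    ∫⁻ x, u x ∂μ = ∫⁻ t in Set.Ioi (0 : ℝ), μ {x | ENNReal.ofReal t < u x} := by
  have hfin : ∀ x, u x ≠ ∞ := fun x => ne_top_of_le_ne_top ENNReal.one_ne_top (h1 x)
  have := lintegral_eq_lintegral_meas_lt μ (f := fun x => (u x).toReal)
    (Eventually.of_forall fun x => ENNReal.toReal_nonneg) hu.ennreal_toReal.aemeasurable
  simp only [ENNReal.ofReal_toReal (hfin _)] at this
  rw [this]
  refine setLIntegral_congr_fun measurableSet_Ioi fun t ht => ?_
  congr 1
  ext x
  simp only [Set.mem_ofPred_eq]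
  exact (ENNReal.ofReal_lt_iff_lt_toReal (le_of_lt ht) (hfin x)).symm

lemma weighted_lintegral_le_of_iSup_eq_one {f g h : ℝ → ℝ≥0∞} {p q : ℝ} (hp : 0 < p) (hq : 0 < q)
    (hpq : p + q = 1) (hf : Measurable f) (hg : Measurable g) (hh : Measurable h)
    (hf1 : ⨆ x, f x = 1) (hg1 : ⨆ x, g x = 1)
    (H : ∀ x y, f x ^ p * g y ^ q ≤ h (p * x + q * y)) :
    ENNReal.ofReal p * (∫⁻ x, f x) + ENNReal.ofReal q * (∫⁻ x, g x) ≤ ∫⁻ x, h x := by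
  have hfle : ∀ x, f x ≤ 1 := fun x => hf1 ▸ le_iSup f x
  have hgle : ∀ x, g x ≤ 1 := fun x => hg1 ▸ le_iSup g x
  have hmeas : ∀ u : ℝ → ℝ≥0∞, Measurable fun t : ℝ => volume {x | ENNReal.ofReal t < u x} := by
    intro u
    refine Antitone.measurable fun s t hst => measure_mono fun x hx => ?_
    exact lt_of_le_of_lt (ENNReal.ofReal_le_ofReal hst) hx
  have hstep : ∫⁻ x, min (h x) 1 ≤ ∫⁻ x, h x := lintegral_mono fun x => min_le_left _ _
  refine le_trans ?_ hstep
  rw [lintegral_eq_lintegral_meas_lt_of_le_one _ hf hfle,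
    lintegral_eq_lintegral_meas_lt_of_le_one _ hg hgle,
    lintegral_eq_lintegral_meas_lt_of_le_one _ (hh.min measurable_const) fun x => min_le_right _ _,
    ← lintegral_const_mul _ (hmeas f), ← lintegral_const_mul _ (hmeas g),
    ← lintegral_add_left ((hmeas f).const_mul _)]
  refine setLIntegral_mono' measurableSet_Ioi fun t ht => ?_
  rcases lt_or_ge t 1 with ht1 | ht1
  · have ht1' : ENNReal.ofReal t < 1 := by
      rw [← ENNReal.ofReal_one]; exact (ENNReal.ofReal_lt_ofReal_iff one_pos).2 ht1
    have hnon : ∀ u : ℝ → ℝ≥0∞, ⨆ x, u x = 1 → {x | ENNReal.ofReal t < u x}.Nonempty := by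
      intro u hu
      obtain ⟨x, hx⟩ := lt_iSup_iff.1 (ht1'.trans_eq hu.symm)
      exact ⟨x, hx⟩
    refine weighted_volume_le hp hq (measurableSet_lt measurable_const hf)
      (measurableSet_lt measurable_const hg) (hnon f hf1) (hnon g hg1) ?_
    intro a ha b hb
    refine lt_min (lt_of_lt_of_le ?_ (H a b)) ht1'
    calc ENNReal.ofReal t = ENNReal.ofReal t ^ p * ENNReal.ofReal t ^ q := by
          rw [← ENNReal.rpow_add_of_nonneg _ _ hp.le hq.le, hpq, ENNReal.rpow_one]
      _ < f a ^ p * g b ^ q :=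
          ENNReal.mul_lt_mul (ENNReal.rpow_lt_rpow ha hp) (ENNReal.rpow_lt_rpow hb hq)
  · have ht1' : 1 ≤ ENNReal.ofReal t := by simpa using ht1
    have e1 : {x | ENNReal.ofReal t < f x} = ∅ := by
      ext x; simpa using (hfle x).trans ht1'
    have e2 : {x | ENNReal.ofReal t < g x} = ∅ := by
      ext x; simpa using (hgle x).trans ht1'
    simp [e1, e2]

lemma prekopaLeindler_real_of_le {f g h : ℝ → ℝ≥0∞} {p q : ℝ} (hp : 0 < p) (hq : 0 < q)
    (hpq : p + q = 1) (hf : Measurable f) (hg : Measurable g) (hh : Measurable h) {N : ℝ≥0∞}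
    (hN : N ≠ ∞) (hfN : ∀ x, f x ≤ N) (hgN : ∀ x, g x ≤ N)
    (H : ∀ x y, f x ^ p * g y ^ q ≤ h (p * x + q * y)) :
    (∫⁻ x, f x) ^ p * (∫⁻ x, g x) ^ q ≤ ∫⁻ x, h x := by
  set a := ⨆ x, f x with ha
  set b := ⨆ x, g x with hb
  have haT : a ≠ ∞ := ne_top_of_le_ne_top hN (iSup_le hfN)
  have hbT : b ≠ ∞ := ne_top_of_le_ne_top hN (iSup_le hgN)
  rcases eq_or_ne a 0 with ha0 | ha0
  · have : ∀ x, f x = 0 := fun x => le_antisymm (ha0 ▸ le_iSup f x) bot_le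
    simp [this, hp]
  rcases eq_or_ne b 0 with hb0 | hb0
  · have : ∀ x, g x = 0 := fun x => le_antisymm (hb0 ▸ le_iSup g x) bot_le
    simp [this, hq]
  have hap0 : a ^ p ≠ 0 := by simp [ha0, haT]
  have hbq0 : b ^ q ≠ 0 := by simp [hb0, hbT]
  have hapT : a ^ p ≠ ∞ := ENNReal.rpow_ne_top_of_nonneg hp.le haT
  have hbqT : b ^ q ≠ ∞ := ENNReal.rpow_ne_top_of_nonneg hq.le hbT
  have hc0 : a ^ p * b ^ q ≠ 0 := mul_ne_zero hap0 hbq0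
  have hcT : a ^ p * b ^ q ≠ ∞ := ENNReal.mul_ne_top hapT hbqT
  have key := weighted_lintegral_le_of_iSup_eq_one (f := fun x => a⁻¹ * f x)
    (g := fun x => b⁻¹ * g x) (h := fun x => (a ^ p * b ^ q)⁻¹ * h x) hp hq hpq
    (hf.const_mul _) (hg.const_mul _) (hh.const_mul _)
    (by rw [← ENNReal.mul_iSup, ← ha, ENNReal.inv_mul_cancel ha0 haT])
    (by rw [← ENNReal.mul_iSup, ← hb, ENNReal.inv_mul_cancel hb0 hbT])
    (by
      intro x y
      rw [ENNReal.mul_rpow_of_nonneg _ _ hp.le, ENNReal.mul_rpow_of_nonneg _ _ hq.le,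
        ENNReal.inv_rpow, ENNReal.inv_rpow, ENNReal.mul_inv (Or.inl hap0) (Or.inl hapT),
        mul_mul_mul_comm]
      gcongr
      exact H x y)
  rw [lintegral_const_mul _ hf, lintegral_const_mul _ hg, lintegral_const_mul _ hh] at key
  have h2 := (ENNReal.rpow_mul_rpow_le_weighted hp hq hpq (a⁻¹ * ∫⁻ x, f x)
    (b⁻¹ * ∫⁻ x, g x)).trans key
  rw [ENNReal.mul_rpow_of_nonneg _ _ hp.le, ENNReal.mul_rpow_of_nonneg _ _ hq.le,
    ENNReal.inv_rpow, ENNReal.inv_rpow, mul_mul_mul_comm,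
    ← ENNReal.mul_inv (Or.inl hap0) (Or.inl hapT)] at h2
  exact (ENNReal.mul_le_mul_iff_right (ENNReal.inv_ne_zero.2 hcT)
    (ENNReal.inv_ne_top.2 hc0)).1 h2

lemma ENNReal.iSup_min_natCast (a : ℝ≥0∞) : ⨆ N : ℕ, min a N = a := by
  have h := congrArg (fun y => a ⊓ y) ENNReal.iSup_natCast
  simp only [inf_top_eq, inf_iSup_eq] at h
  exact h

lemma prekopaLeindler_real {f g h : ℝ → ℝ≥0∞} {p q : ℝ} (hp : 0 < p) (hq : 0 < q)
    (hpq : p + q = 1) (hf : Measurable f) (hg : Measurable g) (hh : Measurable h)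
    (H : ∀ x y, f x ^ p * g y ^ q ≤ h (p * x + q * y)) :
    (∫⁻ x, f x) ^ p * (∫⁻ x, g x) ^ q ≤ ∫⁻ x, h x := by
  have hmono : ∀ u : ℝ → ℝ≥0∞, Monotone fun (N : ℕ) x => min (u x) (N : ℝ≥0∞) :=
    fun u M N hMN x => min_le_min le_rfl (by exact_mod_cast hMN)
  have hlim : ∀ u : ℝ → ℝ≥0∞, Measurable u →
      Tendsto (fun N : ℕ => ∫⁻ x, min (u x) (N : ℝ≥0∞)) atTop (𝓝 (∫⁻ x, u x)) := by
    intro u hu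
    have := lintegral_iSup (μ := volume) (f := fun (N : ℕ) x => min (u x) (N : ℝ≥0∞))
      (fun N => hu.min measurable_const) (hmono u)
    simp only [ENNReal.iSup_min_natCast] at this
    rw [this]
    exact tendsto_atTop_iSup fun M N hMN => lintegral_mono (hmono u hMN)
  have hbound : ∀ N : ℕ, (∫⁻ x, min (f x) (N : ℝ≥0∞)) ^ p * (∫⁻ x, min (g x) (N : ℝ≥0∞)) ^ q
      ≤ ∫⁻ x, h x := by
    intro N
    refine prekopaLeindler_real_of_le hp hq hpq (hf.min measurable_const)
      (hg.min measurable_const) hh (ENNReal.natCast_ne_top N) (fun x => min_le_right _ _)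
      (fun x => min_le_right _ _) fun x y => le_trans ?_ (H x y)
    gcongr <;> exact min_le_left _ _
  rcases eq_or_ne (∫⁻ x, f x) 0 with hf0 | hf0
  · simp [hf0, hp]
  rcases eq_or_ne (∫⁻ x, g x) 0 with hg0 | hg0
  · simp [hg0, hq]
  refine le_of_tendsto' (ENNReal.Tendsto.mul ((hlim f hf).ennrpow_const p) (Or.inl ?_)
    ((hlim g hg).ennrpow_const q) (Or.inl ?_)) hbound
  · simp [hf0, hp.not_gt]
  · simp [hg0, hq.not_gt]

lemma prekopaLeindler_pi {p q : ℝ} (hp : 0 < p) (hq : 0 < q) (hpq : p + q = 1) (n : ℕ)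
    {f g h : (Fin n → ℝ) → ℝ≥0∞} (hf : Measurable f) (hg : Measurable g) (hh : Measurable h)
    (H : ∀ x y, f x ^ p * g y ^ q ≤ h (p • x + q • y)) :
    (∫⁻ x, f x) ^ p * (∫⁻ x, g x) ^ q ≤ ∫⁻ x, h x := by
  induction n with
  | zero =>
    rw [volume_pi, Measure.pi_of_empty (fun _ => volume) 0]
    simp only [lintegral_dirac]
    exact (H 0 0).trans_eq (by congr 1; exact Subsingleton.elim _ _)
  | succ n ih =>
    have hint : ∀ {u : (Fin (n + 1) → ℝ) → ℝ≥0∞}, Measurable u →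
        ∫⁻ x, u x = ∫⁻ s : ℝ, ∫⁻ y : Fin n → ℝ, u (Fin.insertNth 0 s y) := by
      intro u hu
      have h1 := (volume_preserving_piFinSuccAbove (fun _ : Fin (n + 1) => ℝ) 0).symm
      rw [← h1.lintegral_comp hu]
      exact lintegral_prod _ (hu.comp (MeasurableEquiv.measurable _)).aemeasurable
    have hmi : Measurable fun z : ℝ × (Fin n → ℝ) =>
        (Fin.insertNth 0 z.1 z.2 : Fin (n + 1) → ℝ) :=
      (MeasurableEquiv.piFinSuccAbove (fun _ : Fin (n + 1) => ℝ) 0).symm.measurable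
    have hmeas : ∀ {u : (Fin (n + 1) → ℝ) → ℝ≥0∞}, Measurable u →
        Measurable fun s : ℝ => ∫⁻ y : Fin n → ℝ, u (Fin.insertNth 0 s y) := fun hu =>
      Measurable.lintegral_prod_right' (f := fun z : ℝ × (Fin n → ℝ) =>
        _ ) (hu.comp hmi)
    have hslice : ∀ {u : (Fin (n + 1) → ℝ) → ℝ≥0∞} (s : ℝ), Measurable u →
        Measurable fun y : Fin n → ℝ => u (Fin.insertNth 0 s y) := fun s hu =>
      hu.comp (hmi.comp measurable_prodMk_left)
    rw [hint hf, hint hg, hint hh]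
    refine prekopaLeindler_real hp hq hpq (hmeas hf) (hmeas hg) (hmeas hh) fun s t => ?_
    refine ih (hslice s hf) (hslice t hg) (hslice _ hh) fun x y => ?_
    refine (H _ _).trans_eq ?_
    congr 1
    ext i
    refine Fin.cases ?_ (fun j => ?_) i <;> simp

variable {E : Type*} [NormedAddCommGroup E] [NormedSpace ℝ E] [FiniteDimensional ℝ E]
  [MeasurableSpace E] [BorelSpace E] (μ : Measure E) [μ.IsAddHaarMeasure]

/-- The Prékopa–Leindler inequality for a Haar measure on a finite-dimensional space. -/
theorem prekopaLeindler {p q : ℝ} (hp : 0 < p) (hq : 0 < q) (hpq : p + q = 1)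
    {f g h : E → ℝ≥0∞} (hf : Measurable f) (hg : Measurable g) (hh : Measurable h)
    (H : ∀ x y, f x ^ p * g y ^ q ≤ h (p • x + q • y)) :
    (∫⁻ x, f x ∂μ) ^ p * (∫⁻ x, g x ∂μ) ^ q ≤ ∫⁻ x, h x ∂μ := by
  let e : E ≃L[ℝ] (Fin (Module.finrank ℝ E) → ℝ) :=
    (Module.finBasis ℝ E).equivFun.toContinuousLinearEquiv
  have : (μ.map e).IsAddHaarMeasure := e.isAddHaarMeasure_map μ
  have hc := Measure.isAddLeftInvariant_eq_smul (μ.map e) volume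
  set c := (μ.map e).addHaarScalarFactor volume
  have hint : ∀ {u : E → ℝ≥0∞}, Measurable u →
      ∫⁻ x, u x ∂μ = (c : ℝ≥0∞) * ∫⁻ y, u (e.symm y) := by
    intro u hu
    have h1 : ∫⁻ x, u x ∂μ = ∫⁻ y, u (e.symm y) ∂(μ.map e) := by
      rw [lintegral_map (f := fun y => u (e.symm y)) (hu.comp e.symm.continuous.measurable)
        e.continuous.measurable]
      simp
    rw [h1, hc, lintegral_smul_measure]
    rfl
  rw [hint hf, hint hg, hint hh, ENNReal.mul_rpow_of_nonneg _ _ hp.le,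
    ENNReal.mul_rpow_of_nonneg _ _ hq.le, mul_mul_mul_comm,
    ← ENNReal.rpow_add_of_nonneg _ _ hp.le hq.le, hpq, ENNReal.rpow_one]
  gcongr
  refine prekopaLeindler_pi hp hq hpq _ (hf.comp e.symm.continuous.measurable)
    (hg.comp e.symm.continuous.measurable) (hh.comp e.symm.continuous.measurable) fun x y => ?_
  simpa using H (e.symm x) (e.symm y)

/-- The multiplicative Brunn–Minkowski inequality. -/
theorem measure_rpow_mul_measure_rpow_le {p q : ℝ} (hp : 0 < p) (hq : 0 < q) (hpq : p + q = 1)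
    {A B C : Set E} (hA : MeasurableSet A) (hB : MeasurableSet B) (hC : MeasurableSet C)
    (H : ∀ x ∈ A, ∀ y ∈ B, p • x + q • y ∈ C) : μ A ^ p * μ B ^ q ≤ μ C := by
  have := prekopaLeindler μ hp hq hpq (f := A.indicator 1) (g := B.indicator 1)
    (h := C.indicator 1) (measurable_one.indicator hA) (measurable_one.indicator hB)
    (measurable_one.indicator hC) (by
      intro x y
      by_cases hx : x ∈ A
      · by_cases hy : y ∈ B
        · simp [hx, hy, H x hx y hy]
        · simp [hy, hq]
      · simp [hx, hp])
  simpa only [lintegral_indicator_one hA, lintegral_indicator_one hB,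
    lintegral_indicator_one hC] using this

end PrekopaLeindler

section Quantile

/-- A finite atomless measure on the line has a quantile function. -/
lemma exists_quantile (ν : Measure ℝ) [IsFiniteMeasure ν] [NullSingletonClass ν] :
    ∃ z : ℝ → ℝ, ∀ θ ∈ Ioo 0 (ν.real univ), ν (Iic (z θ)) = ENNReal.ofReal θ := by
  have hcont : Continuous fun t => ν.real (Iic t) := by
    have h1 : Continuous fun b => ∫ _ in (0 : ℝ)..b, (1 : ℝ) ∂ν :=
      intervalIntegral.continuous_primitive (fun a b => intervalIntegrable_const) 0
    have h2 : (fun t => ν.real (Iic t)) =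
        fun t => ν.real (Iic 0) + ∫ _ in (0 : ℝ)..t, (1 : ℝ) ∂ν := by
      ext t
      have := intervalIntegral.integral_Iic_sub_Iic (μ := ν) (f := fun _ => (1 : ℝ)) (a := 0)
        (b := t)
        (integrable_const _) (integrable_const _)
      simp only [integral_const, smul_eq_mul, mul_one, measureReal_restrict_apply_univ] at this
      linarith
    rw [h2]
    exact continuous_const.add h1
  have hbot : Tendsto (fun t => ν.real (Iic t)) atBot (𝓝 0) := by
    have h := tendsto_measure_iInter_atBot (μ := ν) (s := fun t : ℝ => Iic t)
      (fun t => measurableSet_Iic.nullMeasurableSet) (fun a b hab => Iic_subset_Iic.2 hab)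
      ⟨0, measure_ne_top _ _⟩
    rw [show ⋂ t : ℝ, Iic t = ∅ by
      ext x; simpa using ⟨x - 1, by linarith⟩, measure_empty] at h
    simpa [Measure.real, Function.comp_def] using (ENNReal.tendsto_toReal (by simp)).comp h
  have htop : Tendsto (fun t => ν.real (Iic t)) atTop (𝓝 (ν.real univ)) := by
    exact (ENNReal.tendsto_toReal (measure_ne_top ν univ)).comp (tendsto_measure_Iic_atTop ν)
  have key : ∀ θ : ℝ, ∃ z : ℝ, θ ∈ Ioo 0 (ν.real univ) → ν (Iic z) = ENNReal.ofReal θ := by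
    intro θ
    by_cases hθ : θ ∈ Ioo 0 (ν.real univ)
    · obtain ⟨a, ha⟩ := (hbot.eventually (gt_mem_nhds hθ.1)).exists
      obtain ⟨b, hb⟩ := (htop.eventually (lt_mem_nhds hθ.2)).exists
      obtain ⟨z, hz⟩ := mem_range_of_exists_le_of_exists_ge hcont ⟨a, ha.le⟩ ⟨b, hb.le⟩
      refine ⟨z, fun _ => ?_⟩
      rw [← hz, ofReal_measureReal]
    · exact ⟨0, fun h => absurd h hθ⟩
  choose z hz using key
  exact ⟨z, hz⟩

variable {ν : Measure ℝ} {V : ℝ} {z : ℝ → ℝ}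

lemma quantile_strictMonoOn (hz : ∀ θ ∈ Ioo 0 V, ν (Iic (z θ)) = ENNReal.ofReal θ) :
    StrictMonoOn z (Ioo 0 V) := by
  intro a ha b hb hab
  by_contra! h
  have := measure_mono (μ := ν) (Iic_subset_Iic.2 h)
  rw [hz a ha, hz b hb, ENNReal.ofReal_le_ofReal_iff ha.1.le] at this
  linarith

lemma aemeasurable_quantile (hz : ∀ θ ∈ Ioo 0 V, ν (Iic (z θ)) = ENNReal.ofReal θ) :
    AEMeasurable z (volume.restrict (Ioo 0 V)) :=
  aemeasurable_restrict_of_monotoneOn measurableSet_Ioo (quantile_strictMonoOn hz).monotoneOn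

/-- The quantile function pushes Lebesgue measure forward to the given measure. -/
lemma map_quantile [IsFiniteMeasure ν] (hV : ν univ = ENNReal.ofReal V)
    (hz : ∀ θ ∈ Ioo 0 V, ν (Iic (z θ)) = ENNReal.ofReal θ) :
    (volume.restrict (Ioo 0 V)).map z = ν := by
  have : IsFiniteMeasure ((volume.restrict (Ioo 0 V)).map z) := inferInstance
  refine Measure.ext_of_Iic _ _ fun t => ?_
  rw [Measure.map_apply_of_aemeasurable (aemeasurable_quantile hz) measurableSet_Iic,
    Measure.restrict_apply' measurableSet_Ioo]
  set a := ν.real (Iic t) with ha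
  have ha' : ν (Iic t) = ENNReal.ofReal a := by rw [ha, ofReal_measureReal]
  have ha0 : 0 ≤ a := measureReal_nonneg
  rw [ha']
  have haV : a ≤ V ∨ a = 0 := by
    have h1 : ν (Iic t) ≤ ν univ := measure_mono (subset_univ _)
    rw [ha', hV] at h1
    rcases ENNReal.ofReal_le_ofReal_iff'.1 h1 with h | h
    · exact Or.inl h
    · exact Or.inr (le_antisymm h ha0)
  apply le_antisymm
  · calc volume (z ⁻¹' Iic t ∩ Ioo 0 V) ≤ volume (Ioc 0 a) := by
          refine measure_mono ?_
          rintro θ ⟨h1, h2⟩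
          refine ⟨h2.1, ?_⟩
          have := measure_mono (μ := ν) (Iic_subset_Iic.2 h1)
          rw [hz θ h2, ha'] at this
          rcases ENNReal.ofReal_le_ofReal_iff'.1 this with h | h
          · exact h
          · exact absurd h2.1 (not_lt.2 h)
      _ = ENNReal.ofReal a := by simp
  · rcases haV with haV | haV
    · calc ENNReal.ofReal a = volume (Ioo 0 a) := by simp
        _ ≤ volume (z ⁻¹' Iic t ∩ Ioo 0 V) := by
          refine measure_mono fun θ hθ => ?_
          have h2 : θ ∈ Ioo 0 V := ⟨hθ.1, hθ.2.trans_le haV⟩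
          refine ⟨?_, h2⟩
          by_contra h
          have h3 : t ≤ z θ := (not_le.1 h).le
          have := measure_mono (μ := ν) (Iic_subset_Iic.2 h3)
          rw [hz θ h2, ha', ENNReal.ofReal_le_ofReal_iff hθ.1.le] at this
          exact absurd hθ.2 (not_lt.2 this)
    · simp [haV]

end Quantile

section CauchySchwarz

/-- The equality case of the Cauchy–Schwarz inequality for exponentials. -/
lemma exists_eq_add_const_of_exp {α : Type*} [MeasurableSpace α] {μ : Measure α} [NeZero μ]
    {u v : α → ℝ} (hu : Integrable (fun x => Real.exp (u x)) μ)
    (hv : Integrable (fun x => Real.exp (v x)) μ)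
    (hw : Integrable (fun x => Real.exp ((u x + v x) / 2)) μ)
    (h : (∫ x, Real.exp (u x) ∂μ) * (∫ x, Real.exp (v x) ∂μ) ≤
      (∫ x, Real.exp ((u x + v x) / 2) ∂μ) ^ 2) :
    ∃ κ : ℝ, ∀ᵐ x ∂μ, u x - v x = κ := by
  set A := ∫ x, Real.exp (u x) ∂μ with hA
  set B := ∫ x, Real.exp (v x) ∂μ with hB
  set C := ∫ x, Real.exp ((u x + v x) / 2) ∂μ with hC
  have hA0 : 0 < A := integral_exp_pos hu
  have hB0 : 0 < B := integral_exp_pos hv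
  have hC0 : 0 < C := integral_exp_pos hw
  have hsq : ∀ x, (√B * Real.exp (u x / 2) - √A * Real.exp (v x / 2)) ^ 2 =
      B * Real.exp (u x) + A * Real.exp (v x) -
        2 * (√A * √B) * Real.exp ((u x + v x) / 2) := by
    intro x
    have e1 : Real.exp (u x) = Real.exp (u x / 2) ^ 2 := by rw [← Real.exp_nat_mul]; ring_nf
    have e2 : Real.exp (v x) = Real.exp (v x / 2) ^ 2 := by rw [← Real.exp_nat_mul]; ring_nf
    have e3 : Real.exp ((u x + v x) / 2) = Real.exp (u x / 2) * Real.exp (v x / 2) := by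
      rw [← Real.exp_add]; ring_nf
    rw [e1, e2, e3]
    linear_combination Real.exp (u x / 2) ^ 2 * Real.sq_sqrt hB0.le +
      Real.exp (v x / 2) ^ 2 * Real.sq_sqrt hA0.le
  have hint : Integrable (fun x => B * Real.exp (u x) + A * Real.exp (v x) -
      2 * (√A * √B) * Real.exp ((u x + v x) / 2)) μ :=
    ((hu.const_mul _).add (hv.const_mul _)).sub (hw.const_mul _)
  have hval : ∫ x, (B * Real.exp (u x) + A * Real.exp (v x) -
      2 * (√A * √B) * Real.exp ((u x + v x) / 2)) ∂μ = B * A + A * B - 2 * (√A * √B) * C := by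
    rw [integral_sub (f := fun x => B * Real.exp (u x) + A * Real.exp (v x))
      ((hu.const_mul _).add (hv.const_mul _)) (hw.const_mul _),
      integral_add (hu.const_mul _) (hv.const_mul _), integral_const_mul, integral_const_mul,
      integral_const_mul]
  have hle : √A * √B ≤ C := by
    rw [← Real.sqrt_mul hA0.le]
    exact Real.sqrt_le_iff.2 ⟨hC0.le, h⟩
  have hAB : (√A * √B) ^ 2 = A * B := by
    rw [mul_pow, Real.sq_sqrt hA0.le, Real.sq_sqrt hB0.le]
  have hnonpos : B * A + A * B - 2 * (√A * √B) * C ≤ 0 := by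
    have : 0 ≤ √A * √B := by positivity
    nlinarith
  have hnn : 0 ≤ᵐ[μ] fun x => B * Real.exp (u x) + A * Real.exp (v x) -
      2 * (√A * √B) * Real.exp ((u x + v x) / 2) :=
    Eventually.of_forall fun x => by
      simp only [Pi.zero_apply]
      rw [← hsq]
      positivity
  have hzero := (integral_eq_zero_iff_of_nonneg_ae hnn hint).1
    (le_antisymm (hval.trans_le hnonpos) (integral_nonneg_of_ae hnn))
  refine ⟨2 * (Real.log √A - Real.log √B), hzero.mono fun x hx => ?_⟩
  have hsA : 0 < √A := Real.sqrt_pos.2 hA0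
  have hsB : 0 < √B := Real.sqrt_pos.2 hB0
  have h1 : √B * Real.exp (u x / 2) = √A * Real.exp (v x / 2) := by
    rw [← sub_eq_zero]
    refine pow_eq_zero_iff (two_ne_zero) |>.1 ?_
    rw [hsq]
    exact hx
  have h2 := congrArg Real.log h1
  rw [Real.log_mul hsB.ne' (Real.exp_ne_zero _), Real.log_mul hsA.ne' (Real.exp_ne_zero _),
    Real.log_exp, Real.log_exp] at h2
  linarith

end CauchySchwarz

section EqualityCase

variable {E : Type*} [NormedAddCommGroup E] [NormedSpace ℝ E] [FiniteDimensional ℝ E]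
  [MeasurableSpace E] [BorelSpace E] (μ : Measure E) [μ.IsAddHaarMeasure]

lemma measure_levelSet_eq_zero {ℓ : E →L[ℝ] ℝ} (hℓ : ℓ ≠ 0) (t : ℝ) : μ {x | ℓ x = t} = 0 := by
  obtain ⟨y, hy⟩ : ∃ y, ℓ y ≠ 0 := by
    by_contra! h
    exact hℓ (ContinuousLinearMap.ext h)
  set x₀ := (t / ℓ y) • y with hx₀
  have hx₀t : ℓ x₀ = t := by simp [hx₀, hy]
  have h1 : {x | ℓ x = t} = (fun x => x + -x₀) ⁻¹' (ℓ.ker : Set E) := by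
    ext x
    simp [hx₀t, ← sub_eq_add_neg, sub_eq_zero]
  rw [h1, measure_preimage_add_right]
  refine Measure.addHaar_submodule μ _ fun h => hy ?_
  have : y ∈ ℓ.ker := h ▸ Submodule.mem_top
  simpa using this

lemma le_measure_of_half_sub_mem {A B C : Set E} (hA : MeasurableSet A) (hB : MeasurableSet B)
    (hC : MeasurableSet C) {a : ℝ≥0∞} (hAa : a ≤ μ A) (hBa : a ≤ μ B)
    (H : ∀ x ∈ A, ∀ y ∈ B, (1 / 2 : ℝ) • (x - y) ∈ C) : a ≤ μ C := by
  have h := measure_rpow_mul_measure_rpow_le μ (p := 1 / 2) (q := 1 / 2) (by norm_num)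
    (by norm_num) (by norm_num) hA hB.neg hC (by
      intro x hx y hy
      have := H x hx (-y) hy
      rwa [sub_neg_eq_add, smul_add] at this)
  rw [Measure.measure_neg] at h
  calc a = a ^ (1 / 2 : ℝ) * a ^ (1 / 2 : ℝ) := by
        rw [← ENNReal.rpow_add_of_nonneg _ _ (by norm_num) (by norm_num)]
        norm_num
    _ ≤ μ A ^ (1 / 2 : ℝ) * μ B ^ (1 / 2 : ℝ) := by gcongr
    _ ≤ μ C := h

lemma integral_exp_mul_integral_exp_le {K M : Set E} (hK : IsCompact K) (hM : IsCompact M)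
    (H : ∀ x ∈ K, ∀ y ∈ K, (1 / 2 : ℝ) • (x - y) ∈ M) (ℓ : E →L[ℝ] ℝ) :
    (∫ x in K, Real.exp (ℓ x) ∂μ) * (∫ x in K, Real.exp (-ℓ x) ∂μ) ≤
      (∫ x in M, Real.exp (ℓ x) ∂μ) ^ 2 := by
  have hexp : Continuous fun x => Real.exp (ℓ x) := Real.continuous_exp.comp ℓ.continuous
  have hexp' : Continuous fun x => Real.exp (-ℓ x) := Real.continuous_exp.comp ℓ.continuous.neg
  have key : ∀ {S : Set E} {φ : E → ℝ}, IsCompact S → Continuous φ → (∀ x, 0 ≤ φ x) →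
      ∫⁻ x, S.indicator (fun x => ENNReal.ofReal (φ x)) x ∂μ =
        ENNReal.ofReal (∫ x in S, φ x ∂μ) := by
    intro S φ hS hφ h0
    rw [lintegral_indicator hS.measurableSet, ofReal_integral_eq_lintegral_ofReal
      (hφ.continuousOn.integrableOn_compact hS) (Eventually.of_forall h0)]
  have hmeas : ∀ {φ : E → ℝ}, Continuous φ → Measurable fun x => ENNReal.ofReal (φ x) :=
    fun h => h.measurable.ennreal_ofReal
  have hPL := prekopaLeindler μ (p := 1 / 2) (q := 1 / 2) (by norm_num) (by norm_num) (by norm_num)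
    ((hmeas hexp).indicator hK.measurableSet) ((hmeas hexp).indicator hK.measurableSet.neg)
    ((hmeas hexp).indicator hM.measurableSet) (by
      intro x y
      by_cases hx : x ∈ K
      · by_cases hy : y ∈ -K
        · have hxy : (1 / 2 : ℝ) • x + (1 / 2 : ℝ) • y ∈ M := by
            have := H x hx (-y) hy
            rwa [sub_neg_eq_add, smul_add] at this
          rw [Set.indicator_of_mem hx, Set.indicator_of_mem hy, Set.indicator_of_mem hxy,
            ENNReal.ofReal_rpow_of_pos (Real.exp_pos _),
            ENNReal.ofReal_rpow_of_pos (Real.exp_pos _),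
            ← ENNReal.ofReal_mul (by positivity), ← Real.exp_mul, ← Real.exp_mul, ← Real.exp_add]
          refine ENNReal.ofReal_le_ofReal (Real.exp_le_exp.2 (le_of_eq ?_))
          simp only [map_add, map_smul, smul_eq_mul]
          ring
        · rw [Set.indicator_of_notMem hy, ENNReal.zero_rpow_of_pos (by norm_num)]
          simp
      · rw [Set.indicator_of_notMem hx, ENNReal.zero_rpow_of_pos (by norm_num)]
        simp)
  have hneg : ∫ x in -K, Real.exp (ℓ x) ∂μ = ∫ x in K, Real.exp (-ℓ x) ∂μ := by
    have := (Measure.measurePreserving_neg μ).setIntegral_preimage_emb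
      (Homeomorph.neg E).measurableEmbedding (fun x => Real.exp (-ℓ x)) K
    simpa using this
  rw [key hK hexp fun x => (Real.exp_pos _).le, key hK.neg hexp fun x => (Real.exp_pos _).le,
    key hM hexp fun x => (Real.exp_pos _).le, hneg] at hPL
  set A := ∫ x in K, Real.exp (ℓ x) ∂μ
  set B := ∫ x in K, Real.exp (-ℓ x) ∂μ
  set C := ∫ x in M, Real.exp (ℓ x) ∂μ
  have hA : 0 ≤ A := integral_nonneg fun x => (Real.exp_pos _).le
  have hB : 0 ≤ B := integral_nonneg fun x => (Real.exp_pos _).le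
  have hC : 0 ≤ C := integral_nonneg fun x => (Real.exp_pos _).le
  rw [ENNReal.ofReal_rpow_of_nonneg hA (by norm_num),
    ENNReal.ofReal_rpow_of_nonneg hB (by norm_num),
    ← ENNReal.ofReal_mul (by positivity), ENNReal.ofReal_le_ofReal_iff hC,
    ← Real.sqrt_eq_rpow, ← Real.sqrt_eq_rpow, ← Real.sqrt_mul hA] at hPL
  exact (Real.sqrt_le_iff.1 hPL).2

lemma measure_inter_le_add_ge {ℓ : E →L[ℝ] ℝ} (hℓ : ℓ ≠ 0) (S : Set E) (t : ℝ) :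
    μ (S ∩ {x | ℓ x ≤ t}) + μ (S ∩ {x | t ≤ ℓ x}) = μ S := by
  have hmle : MeasurableSet {x | ℓ x ≤ t} :=
    measurableSet_le ℓ.continuous.measurable measurable_const
  rw [← measure_inter_add_sdiff S hmle]
  congr 1
  refine measure_congr ?_
  have h0 : ∀ᵐ x ∂μ, ℓ x ≠ t := measure_eq_zero_iff_ae_notMem.1 (measure_levelSet_eq_zero μ hℓ t)
  filter_upwards [h0] with x hx
  refine propext (and_congr_right fun _ => ?_)
  change t ≤ ℓ x ↔ ¬ (ℓ x ≤ t)
  rw [not_le]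
  exact ⟨fun h => lt_of_le_of_ne h (Ne.symm hx), le_of_lt⟩

/-- If the difference body has no more volume than the body itself, then the distribution of every
linear functional on the body is symmetric. -/
lemma exists_map_sub_eq {K M : Set E} (hK : IsCompact K) (hM : IsCompact M)
    (H : ∀ x ∈ K, ∀ y ∈ K, (1 / 2 : ℝ) • (x - y) ∈ M) (hK0 : μ K ≠ 0) (hMK : μ M ≤ μ K)
    {ℓ : E →L[ℝ] ℝ} (hℓ : ℓ ≠ 0) :
    ∃ κ : ℝ, ((μ.restrict K).map ℓ).map (fun t => κ - t) = (μ.restrict K).map ℓ := by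
  have hℓm : Measurable ℓ := ℓ.continuous.measurable
  have hKtop : μ K ≠ ∞ := hK.measure_ne_top
  have hMtop : μ M ≠ ∞ := hM.measure_ne_top
  have hKm := hK.measurableSet
  have hMm := hM.measurableSet
  have : IsFiniteMeasure (μ.restrict K) := ⟨by simpa using hKtop.lt_top⟩
  have : IsFiniteMeasure (μ.restrict M) := ⟨by simpa using hMtop.lt_top⟩
  set ν := (μ.restrict K).map ℓ with hν
  have hmle : ∀ t, MeasurableSet {x | ℓ x ≤ t} := fun t => measurableSet_le hℓm measurable_const
  have hmge : ∀ t, MeasurableSet {x | t ≤ ℓ x} := fun t => measurableSet_le measurable_const hℓm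
  have hνle : ∀ t, ν (Iic t) = μ (K ∩ {x | ℓ x ≤ t}) := fun t => by
    rw [hν, Measure.map_apply hℓm measurableSet_Iic, Measure.restrict_apply' hKm, inter_comm]
    rfl
  have hat : NullSingletonClass ν := ⟨fun t => by
    rw [hν, Measure.map_apply hℓm (measurableSet_singleton t)]
    exact measure_mono_null (Subset.rfl) (le_antisymm ((Measure.restrict_apply_le _ _).trans
      (measure_levelSet_eq_zero μ hℓ t).le) bot_le)⟩
  set V := ν.real univ with hVdef
  have hνV : ν univ = ENNReal.ofReal V := by rw [hVdef, ofReal_measureReal]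
  have hKV : μ K = ENNReal.ofReal V := by
    rw [← hνV, hν, Measure.map_apply hℓm MeasurableSet.univ]
    simp
  have hV0 : 0 < V := by
    rw [hKV] at hK0
    simpa using hK0
  obtain ⟨z, hz⟩ := exists_quantile ν
  have hrefl : ∀ {θ}, θ ∈ Ioo 0 V → V - θ ∈ Ioo 0 V := fun h =>
    ⟨by linarith [h.2], by linarith [h.1]⟩
  have hlow : ∀ θ ∈ Ioo 0 V, μ (K ∩ {x | ℓ x ≤ z θ}) = ENNReal.ofReal θ := fun θ hθ => by
    rw [← hνle, hz θ hθ]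
  have hupp : ∀ θ ∈ Ioo 0 V, μ (K ∩ {x | z θ ≤ ℓ x}) = ENNReal.ofReal (V - θ) := fun θ hθ => by
    have h := measure_inter_le_add_ge μ hℓ K (z θ)
    rw [hlow θ hθ, hKV] at h
    rw [ENNReal.ofReal_sub _ hθ.1.le, ← h]
    exact (ENNReal.add_sub_cancel_left ENNReal.ofReal_ne_top).symm
  set m : ℝ → ℝ := fun θ => (z θ + -z (V - θ)) / 2 with hm
  set νM := (μ.restrict M).map ℓ with hνM
  have hMge : ∀ θ ∈ Ioo 0 V, ENNReal.ofReal θ ≤ μ (M ∩ {x | ℓ x ≤ m θ}) := fun θ hθ => by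
    refine le_measure_of_half_sub_mem μ (hKm.inter (hmle (z θ))) (hKm.inter (hmge (z (V - θ))))
      (hMm.inter (hmle _)) (hlow θ hθ).ge (by rw [hupp _ (hrefl hθ), sub_sub_cancel]) ?_
    rintro x ⟨hx, hx'⟩ y ⟨hy, hy'⟩
    refine ⟨H x hx y hy, ?_⟩
    simp only [Set.mem_ofPred_eq] at hx' hy' ⊢
    rw [map_smul, map_sub, smul_eq_mul, hm]
    linarith
  have hMge' : ∀ θ ∈ Ioo 0 V, ENNReal.ofReal (V - θ) ≤ μ (M ∩ {x | m θ ≤ ℓ x}) := fun θ hθ => by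
    refine le_measure_of_half_sub_mem μ (hKm.inter (hmge (z θ))) (hKm.inter (hmle (z (V - θ))))
      (hMm.inter (hmge _)) (hupp θ hθ).ge (hlow _ (hrefl hθ)).ge ?_
    rintro x ⟨hx, hx'⟩ y ⟨hy, hy'⟩
    refine ⟨H x hx y hy, ?_⟩
    simp only [Set.mem_ofPred_eq] at hx' hy' ⊢
    rw [map_smul, map_sub, smul_eq_mul, hm]
    linarith
  have hMz : ∀ θ ∈ Ioo 0 V, νM (Iic (m θ)) = ENNReal.ofReal θ := fun θ hθ => by
    rw [hνM, Measure.map_apply hℓm measurableSet_Iic, Measure.restrict_apply' hMm, inter_comm]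
    change μ (M ∩ {x | ℓ x ≤ m θ}) = _
    refine le_antisymm ?_ (hMge θ hθ)
    have h := measure_inter_le_add_ge μ hℓ M (m θ)
    have h2 : μ (M ∩ {x | ℓ x ≤ m θ}) + ENNReal.ofReal (V - θ) ≤
        ENNReal.ofReal θ + ENNReal.ofReal (V - θ) := by
      calc _ ≤ μ (M ∩ {x | ℓ x ≤ m θ}) + μ (M ∩ {x | m θ ≤ ℓ x}) := by gcongr; exact hMge' θ hθ
        _ = μ M := h
        _ ≤ ENNReal.ofReal V := hKV ▸ hMK
        _ = _ := by
          rw [← ENNReal.ofReal_add hθ.1.le (hrefl hθ).1.le, add_sub_cancel]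
    exact (ENNReal.add_le_add_iff_right ENNReal.ofReal_ne_top).1 h2
  have hνMV : νM univ = ENNReal.ofReal V := by
    rw [hνM, Measure.map_apply hℓm MeasurableSet.univ, preimage_univ, Measure.restrict_apply_univ]
    exact le_antisymm (hKV ▸ hMK)
      (hKV ▸ le_measure_of_half_sub_mem μ hKm hKm hMm le_rfl le_rfl H)
  set lam : Measure ℝ := volume.restrict (Ioo 0 V) with hlam
  have hzmap : lam.map z = ν := map_quantile hνV hz
  have hmmap : lam.map m = νM := map_quantile hνMV hMz
  have hza : AEMeasurable z lam := aemeasurable_quantile hz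
  have hma : AEMeasurable m lam := aemeasurable_quantile hMz
  have hmp : MeasurePreserving (fun θ => V - θ) lam lam := by
    have := (Measure.measurePreserving_sub_left (volume : Measure ℝ) V).restrict_preimage
      (measurableSet_Ioo (a := 0) (b := V))
    simpa [hlam] using this
  have htrans : ∀ {ρ : Measure ℝ} {g : ℝ → ℝ} {S : Set E} {w : ℝ → ℝ}, IsCompact S → Continuous g →
      AEMeasurable w lam → ρ = (μ.restrict S).map ℓ → lam.map w = ρ →
      Integrable (fun θ => g (w θ)) lam ∧ ∫ θ, g (w θ) ∂lam = ∫ x in S, g (ℓ x) ∂μ := by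
    intro ρ g S w hS hg hw hρ hwρ
    have h1 : Integrable g ρ := by
      rw [hρ, integrable_map_measure hg.aestronglyMeasurable hℓm.aemeasurable]
      exact (hg.comp ℓ.continuous).continuousOn.integrableOn_compact hS
    constructor
    · rw [← hwρ, integrable_map_measure hg.aestronglyMeasurable hw] at h1
      exact h1
    · rw [← integral_map (f := g) hw hg.aestronglyMeasurable, hwρ, hρ,
        integral_map hℓm.aemeasurable hg.aestronglyMeasurable]
  have hza' : AEMeasurable (fun θ => z (V - θ)) lam :=
    (hmp.map_eq.symm ▸ hza : AEMeasurable z (lam.map fun θ => V - θ)).comp_measurable hmp.measurable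
  have hzmap' : lam.map (fun θ => z (V - θ)) = ν := by
    rw [← hzmap]
    nth_rewrite 2 [← hmp.map_eq]
    exact (AEMeasurable.map_map_of_aemeasurable (g := z) (f := fun θ => V - θ)
      (hmp.map_eq.symm ▸ hza) hmp.measurable.aemeasurable).symm
  have t1 := htrans (g := fun t => Real.exp t) hK Real.continuous_exp hza hν hzmap
  have t2 := htrans (g := fun t => Real.exp (-t)) hK (Real.continuous_exp.comp continuous_neg)
    hza' hν hzmap'
  have t3 := htrans (g := fun t => Real.exp t) hM Real.continuous_exp hma hνM hmmap
  have : NeZero lam := ⟨by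
    rw [hlam, Ne, Measure.restrict_eq_zero, Real.volume_Ioo]
    simpa using hV0⟩
  have hPL := integral_exp_mul_integral_exp_le μ hK hM H ℓ
  rw [← t1.2, ← t2.2, ← t3.2] at hPL
  obtain ⟨κ, hκ⟩ := exists_eq_add_const_of_exp (u := z) (v := fun θ => -z (V - θ))
    t1.1 t2.1 t3.1 hPL
  refine ⟨κ, ?_⟩
  calc ν.map (fun t => κ - t) = lam.map (fun θ => κ - z θ) := by
        rw [← hzmap]
        exact AEMeasurable.map_map_of_aemeasurable
          ((measurable_const.sub measurable_id).aemeasurable) hza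
    _ = lam.map (fun θ => z (V - θ)) := by
        refine Measure.map_congr (hκ.mono fun θ hθ => ?_)
        simp only at hθ ⊢
        linarith
    _ = ν := hzmap'

/-- The equality case of `μ K ≤ μ (½ (K - K))`: the body `K` is symmetric about a point. -/
theorem exists_sub_mem_of_measure_le {K M : Set E} (hK : IsCompact K) (hconv : Convex ℝ K)
    (hint : (interior K).Nonempty) (hM : IsCompact M)
    (H : ∀ x ∈ K, ∀ y ∈ K, (1 / 2 : ℝ) • (x - y) ∈ M) (hMK : μ M ≤ μ K) :
    ∃ w : E, ∀ x ∈ K, w - x ∈ K := by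
  have hK0 : μ K ≠ 0 :=
    ((isOpen_interior.measure_pos μ hint).trans_le (measure_mono interior_subset)).ne'
  have hKtop : μ K ≠ ∞ := hK.measure_ne_top
  have : IsFiniteMeasure (μ.restrict K) := ⟨by simpa using hKtop.lt_top⟩
  set V := μ.real K with hV
  have hV0 : 0 < V := ENNReal.toReal_pos hK0 hKtop
  have hidint : Integrable (fun x : E => x) (μ.restrict K) :=
    continuous_id.continuousOn.integrableOn_compact hK
  refine ⟨(2 / V) • ∫ x in K, x ∂μ, fun x hx => ?_⟩
  set w := (2 / V) • ∫ x in K, x ∂μ with hw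
  by_contra hwx
  obtain ⟨ℓ, u, hu, hKu⟩ := geometric_hahn_banach_point_closed hconv hK.isClosed hwx
  have hℓ : ℓ ≠ 0 := by
    rintro rfl
    exact absurd (hu.trans (hKu x hx)) (by simp)
  have hℓm : Measurable ℓ := ℓ.continuous.measurable
  obtain ⟨κ, hκ⟩ := exists_map_sub_eq μ hK hM H hK0 hMK hℓ
  have hκw : κ = ℓ w := by
    have hid : ∀ ρ : Measure ℝ, AEStronglyMeasurable (fun t : ℝ => t) ρ := fun ρ =>
      aestronglyMeasurable_id
    have hνid : Integrable (fun t : ℝ => t) ((μ.restrict K).map ℓ) := by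
      rw [integrable_map_measure (hid _) hℓm.aemeasurable]
      exact ℓ.integrable_comp hidint
    have h1 : ∫ t, t ∂((μ.restrict K).map ℓ) = ℓ (∫ x in K, x ∂μ) := by
      rw [integral_map hℓm.aemeasurable (hid _)]
      exact ℓ.integral_comp_comm hidint
    have h2 : ∫ t, t ∂((μ.restrict K).map ℓ) = κ * V - ∫ t, t ∂((μ.restrict K).map ℓ) := by
      nth_rewrite 1 [← hκ]
      rw [integral_map (φ := fun t => κ - t) (by fun_prop) (hid _),
        integral_sub (integrable_const _) hνid, integral_const, smul_eq_mul, mul_comm]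
      congr 2
      rw [Measure.real, Measure.map_apply hℓm MeasurableSet.univ]
      simp [hV, Measure.real]
    rw [hw, map_smul, smul_eq_mul, ← h1]
    field_simp
    linarith
  have hnull : μ (K ∩ {y | κ - u < ℓ y}) = 0 := by
    have h0 : (μ.restrict K).map ℓ (Iio u) = 0 := by
      rw [Measure.map_apply hℓm measurableSet_Iio, Measure.restrict_apply' hK.measurableSet]
      refine measure_mono_null (t := ∅) ?_ measure_empty
      rintro y ⟨h1, h2⟩
      exact absurd (hKu y h2) (not_lt.2 (le_of_lt h1))
    rw [← hκ, Measure.map_apply (by fun_prop) measurableSet_Iio,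
      Measure.map_apply hℓm (measurableSet_Iio.preimage (by fun_prop)),
      Measure.restrict_apply' hK.measurableSet] at h0
    refine measure_mono_null ?_ h0
    rintro y ⟨h1, h2⟩
    refine ⟨?_, h1⟩
    simp only [mem_preimage, mem_Iio, Set.mem_ofPred_eq] at h2 ⊢
    linarith
  have hopen : IsOpen {y | κ - u < ℓ y} := isOpen_lt continuous_const ℓ.continuous
  have hxU : x ∈ {y | κ - u < ℓ y} := by
    rw [map_sub] at hu
    simp only [Set.mem_ofPred_eq]
    linarith
  have hxcl : x ∈ closure (interior K) := by
    rw [hconv.closure_interior_eq_closure_of_nonempty_interior hint]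
    exact subset_closure hx
  have hne := mem_closure_iff.1 hxcl _ hopen hxU
  refine ((hopen.inter isOpen_interior).measure_pos μ hne).ne' (measure_mono_null ?_ hnull)
  rintro y ⟨h1, h2⟩
  exact ⟨interior_subset h2, h1⟩

end EqualityCase

section Caps

variable {E : Type*} [NormedAddCommGroup E] [NormedSpace ℝ E]
  [MeasurableSpace E] [BorelSpace E] (μ : Measure E) [μ.IsAddHaarMeasure]

/-- A set lying in a thin slab has measure small compared to the slab swept out by its translates
in a direction transversal to the slab. -/
lemma measure_real_le_mul_of_translates {S T : Set E} (hS : MeasurableSet S) (hT : μ T ≠ ∞)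
    {b : E →L[ℝ] ℝ} {u : E} (hu : b u = 1) {ε : ℝ} (hε : 0 < ε)
    (hSb : ∀ x ∈ S, 1 - ε < b x ∧ b x ≤ 1)
    (hST : ∀ x ∈ S, ∀ t ∈ Icc (0 : ℝ) 1, x + t • u ∈ T) :
    μ.real S ≤ ε * μ.real T := by
  set N := ⌊1 / ε⌋₊ + 1 with hN
  have hN1 : 1 / ε < N := by rw [hN]; exact_mod_cast Nat.lt_floor_add_one (1 / ε)
  have hN2 : ∀ j ∈ Finset.range N, (j : ℝ) * ε ∈ Icc (0 : ℝ) 1 := by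
    intro j hj
    have h1 : j ≤ ⌊1 / ε⌋₊ := Nat.lt_succ_iff.1 (Finset.mem_range.1 hj)
    have h2 : (j : ℝ) ≤ 1 / ε := (Nat.le_floor_iff (by positivity)).1 h1
    exact ⟨by positivity, (le_div_iff₀ hε).1 h2⟩
  set F : ℕ → Set E := fun j => (fun x => x + -((j : ℝ) * ε) • u) ⁻¹' S with hF
  have hFm : ∀ j, MeasurableSet (F j) := fun j => hS.preimage (measurable_add_const _)
  have hFμ : ∀ j, μ (F j) = μ S := fun j => measure_preimage_add_right μ _ S
  have hFb : ∀ j, ∀ x ∈ F j, 1 - ε + j * ε < b x ∧ b x ≤ 1 + j * ε := by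
    intro j x hx
    have := hSb _ hx
    rw [map_add, map_smul, hu, smul_eq_mul] at this
    constructor <;> linarith [this.1, this.2]
  have hdisj : ∀ i j, i < j → Disjoint (F i) (F j) := by
    intro i j hij
    rw [Set.disjoint_left]
    intro x hi hj
    have h1 := (hFb i x hi).2
    have h2 := (hFb j x hj).1
    have h3 : (i : ℝ) + 1 ≤ j := by exact_mod_cast hij
    nlinarith
  have hsum : μ (⋃ j ∈ Finset.range N, F j) = N * μ S := by
    rw [measure_biUnion_finset _ fun j _ => hFm j]
    · simp [hFμ]
    · intro i _ j _ hij
      rcases lt_or_gt_of_ne hij with h | h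
      · exact hdisj i j h
      · exact (hdisj j i h).symm
  have hsub : (⋃ j ∈ Finset.range N, F j) ⊆ T := by
    intro x hx
    simp only [mem_iUnion] at hx
    obtain ⟨j, hj, hx⟩ := hx
    have := hST _ hx _ (hN2 j hj)
    simpa using this
  have h := ENNReal.toReal_mono hT (hsum ▸ measure_mono hsub)
  rw [ENNReal.toReal_mul, ENNReal.toReal_natCast] at h
  change N * μ.real S ≤ μ.real T at h
  have h1 : 0 ≤ μ.real S := measureReal_nonneg
  have h2 : 1 / ε * μ.real S ≤ μ.real T := le_trans (by gcongr) h
  calc μ.real S = ε * (1 / ε * μ.real S) := by field_simp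
    _ ≤ ε * μ.real T := by gcongr

variable [FiniteDimensional ℝ E]

lemma tendsto_measure_inter_slab {C : Set E} (hC : IsCompact C) {b : E →L[ℝ] ℝ} (hb : b ≠ 0)
    (t : ℝ) : Tendsto (fun ε => μ (C ∩ {x | t - ε < b x ∧ b x ≤ t})) (𝓝[>] 0) (𝓝 0) := by
  have hbm : Measurable b := b.continuous.measurable
  have h := tendsto_measure_biInter_gt (μ := μ) (a := (0 : ℝ))
    (s := fun ε : ℝ => C ∩ {x | t - ε < b x ∧ b x ≤ t})
    (fun r _ => (hC.measurableSet.inter ((measurableSet_lt measurable_const hbm).inter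
      (measurableSet_le hbm measurable_const))).nullMeasurableSet)
    (fun i j _ hij x hx => ⟨hx.1, lt_of_le_of_lt (by linarith) hx.2.1, hx.2.2⟩)
    ⟨1, one_pos, ((measure_mono inter_subset_left).trans_lt hC.measure_lt_top).ne⟩
  have h0 : μ (⋂ r : ℝ, ⋂ (_ : r > 0), C ∩ {x | t - r < b x ∧ b x ≤ t}) = 0 := by
    refine measure_mono_null ?_ (measure_levelSet_eq_zero μ hb t)
    intro x hx
    simp only [mem_iInter, mem_inter_iff, Set.mem_ofPred_eq] at hx ⊢
    refine le_antisymm (hx 1 one_pos).2.2 (le_of_forall_pos_lt_add fun r hr => ?_)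
    have := (hx r hr).2.1
    linarith
  rwa [h0] at h

/-- Caps of a convex body in two distinct directions have small overlap. -/
lemma eventually_measure_cap_inter_cap_le {K : Set E} (hK : IsCompact K) {b b' : E →L[ℝ] ℝ}
    (hb : ∀ x ∈ K, b x ≤ 1) (hb' : ∀ x ∈ K, b' x ≤ 1) (hb1 : ∃ x ∈ K, b x = 1)
    (hb1' : ∃ x ∈ K, b' x = 1) (hne : b ≠ b') {η : ℝ} (hη : 0 < η) :
    ∀ᶠ ε in 𝓝[>] (0 : ℝ), μ.real ((K ∩ {x | 1 - ε < b x}) ∩ (K ∩ {x | 1 - ε < b' x})) ≤ η * ε := by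
  have hb0 : b ≠ 0 := by
    rintro rfl
    obtain ⟨x, _, hx⟩ := hb1
    simp at hx
  by_cases hker : ∃ u, b u = 0 ∧ b' u ≠ 0
  · obtain ⟨u, hu, hu'⟩ : ∃ u, b u = 0 ∧ b' u = 1 := by
      obtain ⟨u, h1, h2⟩ := hker
      exact ⟨(b' u)⁻¹ • u, by simp [h1], by simp [h2]⟩
    set C : Set E := (fun p : E × ℝ => p.1 + p.2 • u) '' (K ×ˢ Icc (0 : ℝ) 1) with hC
    have hCc : IsCompact C := (hK.prod isCompact_Icc).image (by fun_prop)
    have ht := tendsto_measure_inter_slab μ hCc hb0 1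
    have ht' : ∀ᶠ ε in 𝓝[>] (0 : ℝ), μ (C ∩ {x | 1 - ε < b x ∧ b x ≤ 1}) < ENNReal.ofReal η :=
      ht.eventually (gt_mem_nhds (by simpa using hη))
    filter_upwards [ht', self_mem_nhdsWithin] with ε h1 hε
    have hε : 0 < ε := hε
    have hTtop : μ (C ∩ {x | 1 - ε < b x ∧ b x ≤ 1}) ≠ ∞ := (h1.trans ENNReal.ofReal_lt_top).ne
    have hm : ∀ c : E →L[ℝ] ℝ, MeasurableSet {x | 1 - ε < c x} := fun c =>
      measurableSet_lt measurable_const c.continuous.measurable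
    refine (measure_real_le_mul_of_translates μ ((hK.measurableSet.inter (hm b)).inter
      (hK.measurableSet.inter (hm b'))) hTtop hu' hε (fun x hx => ⟨hx.2.2, hb' x hx.1.1⟩)
      (fun x hx t ht => ⟨⟨(x, t), ⟨hx.1.1, ht⟩, rfl⟩, ?_⟩)).trans ?_
    · simp only [Set.mem_ofPred_eq, map_add, map_smul, hu, smul_zero, add_zero]
      exact ⟨hx.1.2, hb x hx.1.1⟩
    · rw [mul_comm]
      gcongr
      exact (ENNReal.toReal_le_of_le_ofReal hη.le h1.le)
  · push Not at hker
    obtain ⟨x₀, hx₀, hbx₀⟩ := hb1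
    obtain ⟨x₁, hx₁, hbx₁⟩ := hb1'
    have hprop : ∀ x, b' x = b' x₀ * b x := by
      intro x
      have h1 := hker (x - b x • x₀) (by simp [hbx₀])
      rw [map_sub, map_smul, smul_eq_mul, sub_eq_zero] at h1
      rw [h1, mul_comm]
    have hle : b' x₀ ≤ 0 := by
      by_contra! hpos
      apply hne
      have h1 := hb' x₀ hx₀
      have h2 := hb x₁ hx₁
      have h3 := hprop x₁
      rw [hbx₁] at h3
      have h4 : b' x₀ = 1 := by nlinarith
      ext x
      rw [hprop x, h4, one_mul]
    filter_upwards [Ioo_mem_nhdsGT (zero_lt_one' ℝ)] with ε hε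
    have hempty : (K ∩ {x | 1 - ε < b x}) ∩ (K ∩ {x | 1 - ε < b' x}) = ∅ := by
      refine Set.eq_empty_iff_forall_notMem.2 fun x hx => ?_
      have h1 : 1 - ε < b x := hx.1.2
      have h2 : 1 - ε < b' x := hx.2.2
      rw [hprop x] at h2
      nlinarith [hε.2]
    rw [hempty, measureReal_empty]
    exact mul_nonneg hη.le hε.1.le

/-- A Bonferroni inequality. -/
lemma sum_measureReal_le_measureReal_biUnion_add {α ι : Type*} [MeasurableSpace α] [DecidableEq ι]
    {ρ : Measure α} (s : Finset ι) {D : ι → Set α} (hD : ∀ i, MeasurableSet (D i))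
    (hfin : ∀ i, ρ (D i) ≠ ∞) :
    ∑ i ∈ s, ρ.real (D i) ≤ ρ.real (⋃ i ∈ s, D i) +
      ∑ p ∈ s.offDiag, ρ.real (D p.1 ∩ D p.2) := by
  induction s using Finset.induction_on with
  | empty => simp
  | insert a s ha ih =>
    rw [Finset.sum_insert ha, Finset.set_biUnion_insert]
    have hU : ρ (⋃ i ∈ s, D i) ≠ ∞ :=
      (measure_biUnion_lt_top s.finite_toSet fun i _ => (hfin i).lt_top).ne
    have h1 := measureReal_union_add_inter (μ := ρ) (s := D a) (t := ⋃ i ∈ s, D i)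
      (s.measurableSet_biUnion fun i _ => hD i) (hfin a) hU
    have h2 : ρ.real (D a ∩ ⋃ i ∈ s, D i) ≤ ∑ i ∈ s, ρ.real (D a ∩ D i) := by
      rw [Set.inter_iUnion₂]
      exact measureReal_biUnion_finset_le s _
    have h3 : ∑ i ∈ s, ρ.real (D a ∩ D i) + ∑ p ∈ s.offDiag, ρ.real (D p.1 ∩ D p.2) ≤
        ∑ p ∈ (insert a s).offDiag, ρ.real (D p.1 ∩ D p.2) := by
      have himg : ∑ i ∈ s, ρ.real (D a ∩ D i) =
          ∑ p ∈ s.map ⟨fun i => (a, i), fun i j h => (Prod.mk.inj h).2⟩,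
            ρ.real (D p.1 ∩ D p.2) := by
        rw [Finset.sum_map]
        rfl
      rw [himg, ← Finset.sum_union]
      · refine Finset.sum_le_sum_of_subset_of_nonneg ?_ fun _ _ _ => measureReal_nonneg
        intro p hp
        simp only [Finset.mem_union, Finset.mem_map, Finset.mem_offDiag, Finset.mem_insert] at hp ⊢
        rcases hp with ⟨i, hi, rfl⟩ | ⟨h1, h2, h3⟩
        · exact ⟨Or.inl rfl, Or.inr hi, fun h : a = i => ha (h ▸ hi)⟩
        · exact ⟨Or.inr h1, Or.inr h2, h3⟩
      · rw [Finset.disjoint_left]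
        intro p hp hp'
        simp only [Finset.mem_map, Finset.mem_offDiag] at hp hp'
        obtain ⟨i, hi, rfl⟩ := hp
        exact ha hp'.1
    linarith

lemma measureReal_smul_of_nonneg {r : ℝ} (hr : 0 ≤ r) (S : Set E) :
    μ.real (r • S) = r ^ Module.finrank ℝ E * μ.real S := by
  rw [Measure.real, Measure.addHaar_smul_of_nonneg μ hr, ENNReal.toReal_mul,
    ENNReal.toReal_ofReal (pow_nonneg hr _)]
  rfl

/-- Caps in distinct directions together have at most the volume of the outer layer of the body, up
to an error of smaller order. -/
lemma eventually_sum_measure_cap_le {ι : Type*} (s : Finset ι) {b : ι → E →L[ℝ] ℝ}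
    (hinj : ∀ i ∈ s, ∀ j ∈ s, i ≠ j → b i ≠ b j) {K : Set E} (hK : IsCompact K)
    (hconv : Convex ℝ K) (h0 : (0 : E) ∈ K) (hb : ∀ i ∈ s, ∀ x ∈ K, b i x ≤ 1)
    (hb1 : ∀ i ∈ s, ∃ x ∈ K, b i x = 1) {η : ℝ} (hη : 0 < η) :
    ∀ᶠ ε in 𝓝[>] (0 : ℝ), ∑ i ∈ s, μ.real (K ∩ {x | 1 - ε < b i x}) ≤
      (1 - (1 - ε) ^ Module.finrank ℝ E) * μ.real K + η * ε := by
  classical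
  have hKtop : μ K ≠ ∞ := hK.measure_ne_top
  set N : ℝ := (s.offDiag.card : ℝ) with hN
  have hN0 : 0 ≤ N := Nat.cast_nonneg _
  have hη' : 0 < η / (N + 1) := by positivity
  have hpairs : ∀ᶠ ε in 𝓝[>] (0 : ℝ), ∀ p ∈ s.offDiag,
      μ.real ((K ∩ {x | 1 - ε < b p.1 x}) ∩ (K ∩ {x | 1 - ε < b p.2 x})) ≤ η / (N + 1) * ε := by
    refine (Finset.eventually_all _).2 fun p hp => ?_
    obtain ⟨h1, h2, h3⟩ := Finset.mem_offDiag.1 hp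
    exact eventually_measure_cap_inter_cap_le μ hK (hb _ h1) (hb _ h2) (hb1 _ h1) (hb1 _ h2)
      (hinj _ h1 _ h2 h3) hη'
  filter_upwards [hpairs, Ioo_mem_nhdsGT (zero_lt_one' ℝ)] with ε hp hε
  have hm : ∀ i, MeasurableSet (K ∩ {x | 1 - ε < b i x}) := fun i =>
    hK.measurableSet.inter (measurableSet_lt measurable_const (b i).continuous.measurable)
  have hbon := sum_measureReal_le_measureReal_biUnion_add (ρ := μ) s hm
    fun i => ((measure_mono inter_subset_left).trans_lt hKtop.lt_top).ne
  have hoff : ∑ p ∈ s.offDiag,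
      μ.real ((K ∩ {x | 1 - ε < b p.1 x}) ∩ (K ∩ {x | 1 - ε < b p.2 x})) ≤ η * ε := by
    refine (Finset.sum_le_card_nsmul _ _ _ hp).trans ?_
    rw [nsmul_eq_mul, ← hN]
    calc N * (η / (N + 1) * ε) = (N / (N + 1)) * (η * ε) := by ring
      _ ≤ 1 * (η * ε) := by
          have : 0 ≤ η * ε := mul_nonneg hη.le hε.1.le
          gcongr
          exact (div_le_one (by positivity)).2 (by linarith)
      _ = η * ε := one_mul _
  have hunion : μ.real (⋃ i ∈ s, K ∩ {x | 1 - ε < b i x}) ≤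
      (1 - (1 - ε) ^ Module.finrank ℝ E) * μ.real K := by
    have hsub : (⋃ i ∈ s, K ∩ {x | 1 - ε < b i x}) ⊆ K \ ((1 - ε) • K) := by
      intro x hx
      simp only [mem_iUnion] at hx
      obtain ⟨i, hi, hxK, hx⟩ := hx
      refine ⟨hxK, ?_⟩
      rintro ⟨y, hy, rfl⟩
      have h1 := hb i hi y hy
      simp only [Set.mem_ofPred_eq, map_smul, smul_eq_mul] at hx
      nlinarith [hε.2]
    have hsK : (1 - ε) • K ⊆ K := by
      rintro _ ⟨y, hy, rfl⟩
      exact hconv.smul_mem_of_zero_mem h0 hy ⟨by linarith [hε.2], by linarith [hε.1]⟩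
    refine (measureReal_mono hsub ((measure_mono sdiff_subset).trans_lt hKtop.lt_top).ne).trans ?_
    rw [measureReal_sdiff hsK (hK.smul (1 - ε)).measurableSet, 
      measureReal_smul_of_nonneg μ (by linarith [hε.2])]
    linarith
  linarith

/-- Up to an error of smaller order, the caps of `K` in direction `ℓ` below the level `b` have no
more volume than the opposite caps above the level `a`. -/
def CapLE (K : Set E) (ℓ : E →L[ℝ] ℝ) (a b : ℝ) : Prop :=
  ∀ η > 0, ∀ᶠ s in 𝓝[>] (0 : ℝ),
    μ.real (K ∩ {x | b - s < ℓ x}) ≤ μ.real (K ∩ {x | ℓ x < a + s}) + η * s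

/-- If every facet cap is dominated by the opposite cap, then the inner parallel body
`{x | a x ≤ 1 - ε κ_a}` loses no more volume to first order than a homothetic copy. -/
lemma eventually_le_measure_innerBody (A : Finset (E →L[ℝ] ℝ)) {K : Set E} (hK : IsCompact K)
    (hconv : Convex ℝ K) (h0 : (0 : E) ∈ K) {κ : (E →L[ℝ] ℝ) → ℝ} (hA : ∀ a ∈ A, ∀ x ∈ K, a x ≤ 1)
    (hA1 : ∀ a ∈ A, ∃ x ∈ K, a x = 1) (hκ0 : ∀ a ∈ A, 0 < κ a) (hκ : ∀ a ∈ A, ∀ x ∈ K, -κ a ≤ a x)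
    (hκ1 : ∀ a ∈ A, ∃ x ∈ K, a x = -κ a) (hcap : ∀ a ∈ A, CapLE μ K a (-κ a) 1)
    {η : ℝ} (hη : 0 < η) :
    ∀ᶠ ε in 𝓝[>] (0 : ℝ), (1 - ε) ^ Module.finrank ℝ E * μ.real K - η * ε ≤
      μ.real (K ∩ {x | ∀ a ∈ A, a x ≤ 1 - ε * κ a}) := by
  have hKtop : μ K ≠ ∞ := hK.measure_ne_top
  set S : ℝ := ∑ a ∈ A, κ a with hS
  have hS0 : 0 ≤ S := Finset.sum_nonneg fun a ha => (hκ0 a ha).le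
  set η' : ℝ := η / 2 / (S + 1) with hη'
  have hη'0 : 0 < η' := by positivity
  have hinj : ∀ a ∈ A, ∀ a' ∈ A, a ≠ a' → -(κ a)⁻¹ • a ≠ -(κ a')⁻¹ • a' := by
    intro a ha a' ha' hne heq
    have h1 : ∀ x, (κ a)⁻¹ * a x = (κ a')⁻¹ * a' x := fun x => by
      have := congrArg (fun f : E →L[ℝ] ℝ => f x) heq
      simpa using this
    have hk := hκ0 a ha
    have hk' := hκ0 a' ha'
    obtain ⟨x, hx, hax⟩ := hA1 a ha
    obtain ⟨x', hx', hax'⟩ := hA1 a' ha'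
    have h2 := h1 x
    have h3 := h1 x'
    rw [hax] at h2
    rw [hax'] at h3
    have h4 := hA a' ha' x hx
    have h5 := hA a ha x' hx'
    have h6 : (κ a)⁻¹ = (κ a')⁻¹ := by
      apply le_antisymm
      · have := mul_le_mul_of_nonneg_left h4 (inv_pos.2 hk').le
        linarith
      · have := mul_le_mul_of_nonneg_left h5 (inv_pos.2 hk).le
        linarith
    apply hne
    ext y
    have h7 := h1 y
    rw [h6] at h7
    exact mul_left_cancel₀ (inv_pos.2 hk').ne' h7
  have hsum := eventually_sum_measure_cap_le μ A (b := fun a => -(κ a)⁻¹ • a) hinj hK hconv h0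
    (fun a ha x hx => by
      have h1 := hκ a ha x hx
      have hk := hκ0 a ha
      rw [smul_apply, smul_eq_mul, neg_mul, neg_le, inv_mul_eq_div,
        le_div_iff₀ hk]
      linarith)
    (fun a ha => by
      obtain ⟨x, hx, hax⟩ := hκ1 a ha
      refine ⟨x, hx, ?_⟩
      rw [smul_apply, hax, smul_eq_mul, neg_mul_neg,
        inv_mul_cancel₀ (hκ0 a ha).ne'])
    (half_pos hη)
  have hcaps : ∀ᶠ ε in 𝓝[>] (0 : ℝ), ∀ a ∈ A, μ.real (K ∩ {x | 1 - ε * κ a < a x}) ≤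
      μ.real (K ∩ {x | a x < -κ a + ε * κ a}) + η' * (ε * κ a) := by
    refine (Finset.eventually_all _).2 fun a ha => ?_
    have ht : Tendsto (fun ε : ℝ => ε * κ a) (𝓝[>] 0) (𝓝[>] 0) := by
      refine tendsto_nhdsWithin_iff.2 ⟨?_, ?_⟩
      · have : Tendsto (fun ε : ℝ => ε * κ a) (𝓝 0) (𝓝 (0 * κ a)) := tendsto_id.mul_const _
        rw [zero_mul] at this
        exact this.mono_left nhdsWithin_le_nhds
      · filter_upwards [self_mem_nhdsWithin] with ε hε
        exact mul_pos hε (hκ0 a ha)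
    exact ht.eventually (hcap a ha η' hη'0)
  filter_upwards [hsum, hcaps, self_mem_nhdsWithin] with ε h1 h2 hε
  have hε : 0 < ε := hε
  set R := K ∩ {x | ∀ a ∈ A, a x ≤ 1 - ε * κ a} with hR
  have hcover : K ⊆ R ∪ ⋃ a ∈ A, K ∩ {x | 1 - ε * κ a < a x} := by
    intro x hx
    by_cases h : ∀ a ∈ A, a x ≤ 1 - ε * κ a
    · exact Or.inl ⟨hx, h⟩
    · push Not at h
      obtain ⟨a, ha, hax⟩ := h
      exact Or.inr (mem_iUnion₂.2 ⟨a, ha, hx, hax⟩)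
  have hsub : (R ∪ ⋃ a ∈ A, K ∩ {x | 1 - ε * κ a < a x}) ⊆ K :=
    union_subset inter_subset_left (iUnion₂_subset fun a _ => inter_subset_left)
  have h3 : μ.real K ≤ μ.real R + ∑ a ∈ A, μ.real (K ∩ {x | 1 - ε * κ a < a x}) := by
    calc μ.real K ≤ μ.real (R ∪ ⋃ a ∈ A, K ∩ {x | 1 - ε * κ a < a x}) :=
          measureReal_mono hcover ((measure_mono hsub).trans_lt hKtop.lt_top).ne
      _ ≤ μ.real R + μ.real (⋃ a ∈ A, K ∩ {x | 1 - ε * κ a < a x}) := measureReal_union_le _ _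
      _ ≤ _ := by gcongr; exact measureReal_biUnion_finset_le A _
  have h4 : ∑ a ∈ A, μ.real (K ∩ {x | 1 - ε * κ a < a x}) ≤
      ∑ a ∈ A, μ.real (K ∩ {x | 1 - ε < (-(κ a)⁻¹ • a) x}) + η / 2 * ε := by
    calc _ ≤ ∑ a ∈ A, (μ.real (K ∩ {x | 1 - ε < (-(κ a)⁻¹ • a) x}) + η' * ε * κ a) := by
          refine Finset.sum_le_sum fun a ha => (h2 a ha).trans_eq ?_
          have hset : {x | a x < -κ a + ε * κ a} = {x | 1 - ε < (-(κ a)⁻¹ • a) x} := by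
            ext x
            have hk := hκ0 a ha
            simp only [Set.mem_ofPred_eq, smul_apply, smul_eq_mul, neg_mul]
            rw [lt_neg, inv_mul_eq_div, div_lt_iff₀ hk]
            constructor <;> intro h <;> linarith
          rw [hset]
          ring
      _ = ∑ a ∈ A, μ.real (K ∩ {x | 1 - ε < (-(κ a)⁻¹ • a) x}) + η' * ε * S := by
          rw [Finset.sum_add_distrib, ← Finset.mul_sum]
      _ ≤ _ := by
          have : η' * ε * S = η / 2 * ε * (S / (S + 1)) := by rw [hη']; ring
          rw [this]
          have : S / (S + 1) ≤ 1 := (div_le_one (by positivity)).2 (by linarith)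
          have h5 : 0 ≤ η / 2 * ε := by positivity
          nlinarith
  linarith

/-- A body all of whose facet caps are dominated by the opposite caps has at least the volume of
its difference body. -/
theorem measure_le_of_capLE (A : Finset (E →L[ℝ] ℝ)) {K M : Set E} (hK : IsCompact K)
    (hM : IsCompact M) (hMK : ∀ z ∈ M, ∃ x ∈ K, ∃ y ∈ K, z = (1 / 2 : ℝ) • (x - y))
    (h0 : (0 : E) ∈ K) (hKA : K = {x | ∀ a ∈ A, a x ≤ 1}) {κ : (E →L[ℝ] ℝ) → ℝ}
    (hA1 : ∀ a ∈ A, ∃ x ∈ K, a x = 1) (hκ0 : ∀ a ∈ A, 0 < κ a) (hκ : ∀ a ∈ A, ∀ x ∈ K, -κ a ≤ a x)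
    (hκ1 : ∀ a ∈ A, ∃ x ∈ K, a x = -κ a) (hcap : ∀ a ∈ A, CapLE μ K a (-κ a) 1)
    (hK0 : μ K ≠ 0) : μ M ≤ μ K := by
  have hKtop : μ K ≠ ∞ := hK.measure_ne_top
  have hMtop : μ M ≠ ∞ := hM.measure_ne_top
  have hA : ∀ a ∈ A, ∀ x ∈ K, a x ≤ 1 := fun a ha x hx => by
    rw [hKA] at hx
    exact hx a ha
  have hconv : Convex ℝ K := by
    rw [hKA]
    have : {x : E | ∀ a ∈ A, a x ≤ 1} = ⋂ a ∈ A, {x | a x ≤ 1} := by ext; simp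
    rw [this]
    exact convex_iInter₂ fun a _ => convex_halfSpace_le a.isLinear 1
  set V := μ.real K with hV
  have hV0 : 0 < V := ENNReal.toReal_pos hK0 hKtop
  by_contra! hlt
  have hlt' : V < μ.real M := (ENNReal.toReal_lt_toReal hKtop hMtop).2 hlt
  set n := Module.finrank ℝ E
  obtain ⟨ρ, hρ1, hρ⟩ : ∃ ρ, 1 < ρ ∧ ρ * V < μ.real M := by
    obtain ⟨t, h1, h2⟩ := exists_between hlt'
    exact ⟨t / V, (one_lt_div hV0).2 h1, by rwa [div_mul_cancel₀ _ hV0.ne']⟩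
  set lam := Real.log ρ with hlam
  have hlam0 : 0 < lam := Real.log_pos hρ1
  have hR := eventually_le_measure_innerBody μ A hK hconv h0 hA hA1 hκ0 hκ hκ1 hcap
    (η := lam * V / 2) (by positivity)
  have hc1 : ∀ᶠ ε in 𝓝[>] (0 : ℝ), 1 / 2 < (1 - ε) ^ n := by
    have : Tendsto (fun ε : ℝ => (1 - ε) ^ n) (𝓝 0) (𝓝 ((1 - 0) ^ n)) :=
      (tendsto_const_nhds.sub tendsto_id).pow n
    simp only [sub_zero, one_pow] at this
    exact (this.mono_left nhdsWithin_le_nhds).eventually (lt_mem_nhds (by norm_num))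
  have hc2 : ∀ᶠ ε in 𝓝[>] (0 : ℝ), ρ * V < (1 - 2 * ε) ^ n * μ.real M := by
    have : Tendsto (fun ε : ℝ => (1 - 2 * ε) ^ n * μ.real M) (𝓝 0)
        (𝓝 ((1 - 2 * 0) ^ n * μ.real M)) :=
      ((tendsto_const_nhds.sub (tendsto_id.const_mul 2)).pow n).mul_const _
    simp only [mul_zero, sub_zero, one_pow, one_mul] at this
    exact (this.mono_left nhdsWithin_le_nhds).eventually (lt_mem_nhds hρ)
  have hc3 : ∀ᶠ ε in 𝓝[>] (0 : ℝ), ε ∈ Ioo (0 : ℝ) (min (1 / 2) (1 / (2 * lam))) :=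
    Ioo_mem_nhdsGT (by positivity)
  obtain ⟨ε, hRε, h1, h2, hε⟩ := (hR.and (hc1.and (hc2.and hc3))).exists
  have hε0 : 0 < ε := hε.1
  have hε2 : ε < 1 / 2 := hε.2.trans_le (min_le_left _ _)
  have hεlam : ε * (2 * lam) < 1 :=
    (lt_div_iff₀ (by positivity)).1 (hε.2.trans_le (min_le_right _ _))
  have h1ε : 0 < 1 - ε := by linarith
  set R := K ∩ {x | ∀ a ∈ A, a x ≤ 1 - ε * κ a} with hRdef
  have hRm : MeasurableSet R := by
    refine hK.measurableSet.inter ?_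
    have : {x : E | ∀ a ∈ A, a x ≤ 1 - ε * κ a} = ⋂ a ∈ A, {x | a x ≤ 1 - ε * κ a} := by ext; simp
    rw [this]
    exact A.measurableSet_biInter fun a _ =>
      measurableSet_le a.continuous.measurable measurable_const
  have hBM := measure_rpow_mul_measure_rpow_le μ (p := 1 - 2 * ε) (q := 2 * ε) (by linarith)
    (by linarith) (by ring) (A := (1 - ε)⁻¹ • R) (B := (1 - 2 * ε) • M) (C := K)
    (hRm.const_smul₀ _) (hM.smul (1 - 2 * ε)).measurableSet hK.measurableSet (by
      rintro _ ⟨r, hr, rfl⟩ _ ⟨z, hz, rfl⟩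
      obtain ⟨x, hx, y, hy, rfl⟩ := hMK z hz
      rw [hKA]
      intro a ha
      have hk := hκ0 a ha
      have hr' : a r ≤ 1 - ε * κ a := hr.2 a ha
      have hxy : a x - a y ≤ 1 + κ a := by linarith [hA a ha x hx, hκ a ha y hy]
      simp only [map_add, map_smul, map_sub, smul_eq_mul]
      have e1 : (1 - 2 * ε) * ((1 - ε)⁻¹ * a r) ≤
          (1 - 2 * ε) * ((1 - ε)⁻¹ * (1 - ε * κ a)) := by
        have h3 : 0 ≤ 1 - 2 * ε := by linarith
        gcongr
      have e2 : 2 * ε * ((1 - 2 * ε) * (1 / 2 * (a x - a y))) ≤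
          2 * ε * ((1 - 2 * ε) * (1 / 2 * (1 + κ a))) := by
        have h3 : 0 ≤ 1 - 2 * ε := by linarith
        gcongr
      refine (add_le_add e1 e2).trans ?_
      have e3 : (1 - 2 * ε) * ((1 - ε)⁻¹ * (1 - ε * κ a)) =
          (1 - 2 * ε) * (1 - ε * κ a) / (1 - ε) := by rw [inv_mul_eq_div, mul_div_assoc]
      rw [e3, ← le_sub_iff_add_le, div_le_iff₀ h1ε]
      have e4 : 0 ≤ (1 + κ a) * (1 - 2 * ε) := by
        have h3 : 0 ≤ 1 - 2 * ε := by linarith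
        positivity
      nlinarith [mul_nonneg (sq_nonneg ε) e4, sq_nonneg ε])
  have hAr : μ.real ((1 - ε)⁻¹ • R) * (1 - ε) ^ n = μ.real R := by
    rw [measureReal_smul_of_nonneg μ (inv_nonneg.2 h1ε.le), inv_pow, mul_comm,
      mul_inv_cancel_left₀ (pow_ne_zero _ h1ε.ne')]
  have hBr : μ.real ((1 - 2 * ε) • M) = (1 - 2 * ε) ^ n * μ.real M :=
    measureReal_smul_of_nonneg μ (by linarith) M
  have hRtop : μ R ≠ ∞ := ((measure_mono inter_subset_left).trans_lt hKtop.lt_top).ne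
  have hBM' := ENNReal.toReal_mono hKtop hBM
  rw [ENNReal.toReal_mul, ← ENNReal.toReal_rpow, ← ENNReal.toReal_rpow] at hBM'
  change μ.real ((1 - ε)⁻¹ • R) ^ (1 - 2 * ε) * μ.real ((1 - 2 * ε) • M) ^ (2 * ε) ≤ V at hBM'
  have hge : (1 - lam * ε) * V ≤ μ.real ((1 - ε)⁻¹ • R) := by
    have hn : 0 < (1 - ε) ^ n := by positivity
    rw [← hAr] at hRε
    refine le_of_mul_le_mul_right ?_ hn
    nlinarith [mul_pos (mul_pos hlam0 hε0) hV0]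
  have hp0 : 0 < 1 - lam * ε := by linarith
  have hgeB : ρ * V ≤ μ.real ((1 - 2 * ε) • M) := by rw [hBr]; exact h2.le
  have hfin : ((1 - lam * ε) * V) ^ (1 - 2 * ε) * (ρ * V) ^ (2 * ε) ≤ V := by
    refine le_trans ?_ hBM'
    have h3 : 0 ≤ 1 - 2 * ε := by linarith
    gcongr
  have hρ0 : 0 < ρ := by linarith
  rw [Real.mul_rpow hp0.le hV0.le, Real.mul_rpow hρ0.le hV0.le, mul_mul_mul_comm,
    ← Real.rpow_add hV0, show 1 - 2 * ε + 2 * ε = 1 by ring, Real.rpow_one] at hfin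
  have hfin' : (1 - lam * ε) ^ (1 - 2 * ε) * ρ ^ (2 * ε) ≤ 1 :=
    le_of_mul_le_mul_right (by simpa using hfin) hV0
  have e1 : 1 - lam * ε ≤ (1 - lam * ε) ^ (1 - 2 * ε) := by
    have := Real.rpow_le_rpow_of_exponent_ge hp0 (by nlinarith [mul_pos hlam0 hε0])
      (show 1 - 2 * ε ≤ 1 by linarith)
    rwa [Real.rpow_one] at this
  have e2 : 1 + 2 * ε * lam ≤ ρ ^ (2 * ε) := by
    rw [Real.rpow_def_of_pos hρ0, ← hlam]
    have := Real.add_one_le_exp (lam * (2 * ε))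
    linarith
  have e3 : (1 - lam * ε) * (1 + 2 * ε * lam) ≤ 1 :=
    (mul_le_mul e1 e2 (by positivity) (by positivity)).trans hfin'
  nlinarith [mul_pos hlam0 hε0]

/-- A convex body is centrally symmetric if all of its facet caps are dominated by the opposite
caps. -/
theorem exists_sub_mem_of_capLE (A : Finset (E →L[ℝ] ℝ)) (h : (E →L[ℝ] ℝ) → ℝ) {K : Set E}
    (hK : IsCompact K) (hconv : Convex ℝ K) (hint : (interior K).Nonempty)
    (hKA : K = {x | ∀ a ∈ A, a x ≤ h a})
    (hcap : ∀ a ∈ A, a ≠ 0 → ∃ lo hi, (∀ x ∈ K, lo ≤ a x ∧ a x ≤ hi) ∧ (∃ x ∈ K, a x = lo) ∧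
      (∃ x ∈ K, a x = hi) ∧ CapLE μ K a lo hi) :
    ∃ w : E, ∀ x ∈ K, w - x ∈ K := by
  classical
  obtain ⟨x₀, hx₀⟩ := hint
  have hx₀K := interior_subset hx₀
  set M : Set E := (fun p : E × E => (1 / 2 : ℝ) • (p.1 - p.2)) '' (K ×ˢ K) with hM
  have hMc : IsCompact M := (hK.prod hK).image (by fun_prop)
  refine exists_sub_mem_of_measure_le μ hK hconv ⟨x₀, hx₀⟩ hMc
    (fun x hx y hy => ⟨(x, y), ⟨hx, hy⟩, rfl⟩) ?_
  have hstrict : ∀ a : E →L[ℝ] ℝ, a ≠ 0 → ∃ x ∈ K, a x₀ < a x := by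
    intro a ha
    obtain ⟨u, hu⟩ : ∃ u, 0 < a u := by
      by_contra! hle
      apply ha
      ext u
      have h1 := hle u
      have h2 := hle (-u)
      rw [map_neg] at h2
      exact le_antisymm h1 (neg_nonpos.1 h2)
    have ht : Tendsto (fun t : ℝ => x₀ + t • u) (𝓝[>] 0) (𝓝 x₀) := by
      have : Tendsto (fun t : ℝ => x₀ + t • u) (𝓝 0) (𝓝 (x₀ + (0 : ℝ) • u)) := by
        apply Continuous.tendsto
        fun_prop
      rw [zero_smul, add_zero] at this
      exact this.mono_left nhdsWithin_le_nhds
    obtain ⟨t, h1, h2⟩ := ((ht.eventually (mem_interior_iff_mem_nhds.1 hx₀)).and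
      self_mem_nhdsWithin).exists
    refine ⟨_, h1, ?_⟩
    rw [map_add, map_smul, smul_eq_mul]
    have := mul_pos (show 0 < t from h2) hu
    linarith
  set K' : Set E := (fun y => y + x₀) ⁻¹' K with hK'
  have hK'c : IsCompact K' := (Homeomorph.addRight x₀).isCompact_preimage.2 hK
  have hμK' : μ K' = μ K := measure_preimage_add_right μ x₀ K
  have hcap' : ∀ a ∈ A, a ≠ 0 → ∃ c > 0, ∃ hi, a x₀ + c = hi ∧ (∀ x ∈ K, a x ≤ hi) ∧
      (∃ x ∈ K, a x = hi) ∧ ∃ κ, 0 < κ ∧ (∀ y ∈ K', -κ ≤ (c⁻¹ • a) y) ∧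
      (∃ y ∈ K', (c⁻¹ • a) y = -κ) ∧ CapLE μ K' (c⁻¹ • a) (-κ) 1 := by
    intro a ha ha0
    obtain ⟨lo, hi, hbd, ⟨xl, hxl, hlo⟩, hhi, hc⟩ := hcap a ha ha0
    obtain ⟨x₁, hx₁, hax₁⟩ := hstrict a ha0
    obtain ⟨x₂, hx₂, hax₂⟩ := hstrict (-a) (neg_ne_zero.2 ha0)
    have hax₂ : a x₂ < a x₀ := by simpa using hax₂
    set c := hi - a x₀ with hcdef
    have hc0 : 0 < c := by linarith [(hbd x₁ hx₁).2]
    have hl0 : 0 < a x₀ - lo := by linarith [(hbd x₂ hx₂).1]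
    refine ⟨c, hc0, hi, by rw [hcdef]; ring, fun x hx => (hbd x hx).2, hhi, (a x₀ - lo) / c,
      by positivity, ?_, ⟨xl - x₀, ?_, ?_⟩, ?_⟩
    · intro y hy
      have h1 := (hbd _ hy).1
      rw [map_add] at h1
      rw [smul_apply, smul_eq_mul, inv_mul_eq_div, ← neg_div, div_le_div_iff_of_pos_right hc0]
      linarith
    · simpa [hK'] using hxl
    · rw [smul_apply, smul_eq_mul, inv_mul_eq_div, ← neg_div, map_sub, hlo, neg_sub]
    · intro η hη
      have ht : Tendsto (fun s : ℝ => c * s) (𝓝[>] 0) (𝓝[>] 0) := by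
        refine tendsto_nhdsWithin_iff.2 ⟨?_, ?_⟩
        · have : Tendsto (fun s : ℝ => c * s) (𝓝 0) (𝓝 (c * 0)) := tendsto_id.const_mul _
          rw [mul_zero] at this
          exact this.mono_left nhdsWithin_le_nhds
        · filter_upwards [self_mem_nhdsWithin] with s hs
          exact mul_pos hc0 hs
      filter_upwards [ht.eventually (hc (η / c) (by positivity))] with s hs
      have e1 : K' ∩ {x | 1 - s < (c⁻¹ • a) x} =
          (fun y => y + x₀) ⁻¹' (K ∩ {x | hi - c * s < a x}) := by
        ext y
        refine and_congr_right fun _ => ?_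
        simp only [Set.mem_ofPred_eq, smul_apply, smul_eq_mul, inv_mul_eq_div]
        rw [lt_div_iff₀ hc0, map_add]
        constructor <;> intro h <;> linarith
      have e2 : K' ∩ {x | (c⁻¹ • a) x < -((a x₀ - lo) / c) + s} =
          (fun y => y + x₀) ⁻¹' (K ∩ {x | a x < lo + c * s}) := by
        ext y
        refine and_congr_right fun _ => ?_
        have e3 : -((a x₀ - lo) / c) + s = (lo - a x₀ + c * s) / c := by field_simp; ring
        simp only [Set.mem_ofPred_eq, smul_apply, smul_eq_mul, inv_mul_eq_div]
        change _ ↔ a (y + x₀) < lo + c * s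
        rw [e3, div_lt_div_iff_of_pos_right hc0, map_add]
        constructor <;> intro h <;> linarith
      rw [e1, e2, measureReal_def, measureReal_def, measure_preimage_add_right,
        measure_preimage_add_right]
      refine hs.trans_eq ?_
      rw [measureReal_def]
      field_simp
  choose! c hc0 hi hhi hle hatt κ' hκ' using hcap'
  set A' : Finset (E →L[ℝ] ℝ) := (A.filter (· ≠ 0)).image fun a => (c a)⁻¹ • a with hA'
  have hA'mem : ∀ a' ∈ A', ∃ a ∈ A, a ≠ 0 ∧ (c a)⁻¹ • a = a' := by
    intro a' ha'
    obtain ⟨a, ha, rfl⟩ := Finset.mem_image.1 ha'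
    exact ⟨a, (Finset.mem_filter.1 ha).1, (Finset.mem_filter.1 ha).2, rfl⟩
  have hκex : ∀ a' ∈ A', ∃ κ, 0 < κ ∧ (∀ y ∈ K', -κ ≤ a' y) ∧
      (∃ y ∈ K', a' y = -κ) ∧ CapLE μ K' a' (-κ) 1 := by
    intro a' ha'
    obtain ⟨a, ha, ha0, rfl⟩ := hA'mem a' ha'
    exact ⟨κ' a, hκ' a ha ha0⟩
  choose! κ hκ using hκex
  rw [← hμK']
  refine measure_le_of_capLE μ A' hK'c hMc ?_ ?_ ?_ ?_ (fun a ha => (hκ a ha).1)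
    (fun a ha => (hκ a ha).2.1) (fun a ha => (hκ a ha).2.2.1) (fun a ha => (hκ a ha).2.2.2) ?_
  · rintro _ ⟨⟨x, y⟩, ⟨hx, hy⟩, rfl⟩
    exact ⟨x - x₀, by simpa [hK'] using hx, y - x₀, by simpa [hK'] using hy, by simp⟩
  · simpa [hK'] using hx₀K
  · ext y
    constructor
    · intro hy a' ha'
      obtain ⟨a, ha, ha0, rfl⟩ := hA'mem a' ha'
      have h1 := hle a ha ha0 _ hy
      have h2 := hhi a ha ha0
      rw [map_add] at h1
      rw [smul_apply, smul_eq_mul, inv_mul_eq_div, div_le_one (hc0 a ha ha0)]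
      linarith
    · intro hy
      change y + x₀ ∈ K
      rw [hKA] at hx₀K ⊢
      intro a ha
      by_cases ha0 : a = 0
      · have := hx₀K a ha
        rw [ha0] at this ⊢
        simpa using this
      · have h1 := hy ((c a)⁻¹ • a) (Finset.mem_image.2 ⟨a, Finset.mem_filter.2 ⟨ha, ha0⟩, rfl⟩)
        rw [smul_apply, smul_eq_mul, inv_mul_eq_div, div_le_one (hc0 a ha ha0)] at h1
        obtain ⟨x, hx, hax⟩ := hatt a ha ha0
        rw [hKA] at hx
        have h2 := hx a ha
        have h3 := hhi a ha ha0
        rw [map_add]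
        linarith
  · intro a' ha'
    obtain ⟨a, ha, ha0, rfl⟩ := hA'mem a' ha'
    obtain ⟨x, hx, hax⟩ := hatt a ha ha0
    refine ⟨x - x₀, by simpa [hK'] using hx, ?_⟩
    have h3 := hhi a ha ha0
    rw [smul_apply, smul_eq_mul, inv_mul_eq_div, div_eq_one_iff_eq (hc0 a ha ha0).ne', map_sub]
    linarith
  · rw [hμK']
    exact ((isOpen_interior.measure_pos μ ⟨x₀, hx₀⟩).trans_le (measure_mono interior_subset)).ne'

end Caps

section Periodic

variable {E : Type*} [NormedAddCommGroup E] [NormedSpace ℝ E] [FiniteDimensional ℝ E]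
  [MeasurableSpace E] [BorelSpace E] (μ : Measure E) [μ.IsAddHaarMeasure]

/-- Unfolding a periodic set over a fundamental domain of a lattice. -/
lemma exists_measure_inter_eq_setLIntegral (L : Submodule ℤ E) [DiscreteTopology L]
    [IsZLattice ℝ L] : ∃ F : Set E, ∀ S W : Set E, MeasurableSet S → MeasurableSet W →
      (∀ g : L, ∀ x, (g : E) + x ∈ W ↔ x ∈ W) →
      μ (S ∩ W) = ∫⁻ x in F, W.indicator 1 x * ∑' g : L, S.indicator (1 : E → ℝ≥0∞) (g + x) ∂μ := by
  let b := Module.Free.chooseBasis ℤ L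
  refine ⟨ZSpan.fundamentalDomain (b.ofZLatticeBasis ℝ), fun S W hS hW hper => ?_⟩
  have : VAddInvariantMeasure L E μ :=
    inferInstanceAs (VAddInvariantMeasure L.toAddSubgroup E μ)
  have hF := ZLattice.isAddFundamentalDomain b μ
  rw [← lintegral_indicator_one (hS.inter hW), hF.lintegral_eq_tsum'', ← lintegral_tsum]
  · refine lintegral_congr fun x => ?_
    rw [← ENNReal.tsum_mul_left]
    refine tsum_congr fun g => ?_
    have h1 : (g +ᵥ x : E) = (g : E) + x := rfl
    rw [h1, Set.inter_indicator_one, Pi.mul_apply, mul_comm]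
    congr 1
    by_cases hx : x ∈ W
    · rw [indicator_of_mem hx, indicator_of_mem ((hper g x).2 hx)]; rfl
    · rw [indicator_of_notMem hx, indicator_of_notMem fun h => hx ((hper g x).1 h)]
  · intro g
    exact ((measurable_one.indicator (hS.inter hW)).comp
      (measurable_const_add (g : E))).aemeasurable

/-- If almost every translate of `K` has as many lattice points as its mirror translate, then `K`
meets every periodic set in the same volume as the reflected set. -/
theorem measure_inter_eq_measure_inter_neg (L : Submodule ℤ E) [DiscreteTopology L]
    [IsZLattice ℝ L] {K W : Set E} (hK : MeasurableSet K) (hW : MeasurableSet W)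
    (hper : ∀ g : L, ∀ x, (g : E) + x ∈ W ↔ x ∈ W)
    (hcount : ∀ᵐ c ∂μ, ∑' g : L, K.indicator (1 : E → ℝ≥0∞) (g - c) =
      ∑' g : L, K.indicator (1 : E → ℝ≥0∞) (g + c)) :
    μ (K ∩ W) = μ (K ∩ -W) := by
  obtain ⟨F, hF⟩ := exists_measure_inter_eq_setLIntegral μ L
  have h1 : μ (K ∩ -W) = μ (-K ∩ W) := by
    rw [← Measure.measure_neg μ (K ∩ -W), Set.inter_neg, neg_neg]
  rw [h1, hF K W hK hW hper, hF (-K) W hK.neg hW hper]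
  refine lintegral_congr_ae ?_
  filter_upwards [ae_restrict_of_ae hcount] with x hx
  rw [← hx]
  congr 1
  rw [← (Equiv.neg L).tsum_eq]
  refine tsum_congr fun g => ?_
  have : -((g : E) + x) = ((-g : L) : E) - x := by push_cast; abel
  by_cases h : ((-g : L) : E) - x ∈ K
  · rw [Equiv.neg_apply, indicator_of_mem h, indicator_of_mem (by rwa [Set.mem_neg, this])]; rfl
  · rw [Equiv.neg_apply, indicator_of_notMem h, indicator_of_notMem (by rwa [Set.mem_neg, this])]

/-- The slab of a convex body just above a level set is not much larger than the slab just
below it. -/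
lemma measureReal_slab_above_le {K : Set E} (hK : IsCompact K) (hconv : Convex ℝ K)
    {ℓ : E →L[ℝ] ℝ} {p : E} (hp : p ∈ K) {k ε : ℝ} (hk : ℓ p + 1 ≤ k) (hε : 0 < ε) (hε1 : ε < 1) :
    μ.real (K ∩ {x | k < ℓ x ∧ ℓ x < k + ε}) ≤ μ.real (K ∩ {x | k - ε < ℓ x ∧ ℓ x < k}) +
      Module.finrank ℝ E * ε * μ.real (K ∩ {x | k < ℓ x ∧ ℓ x < k + ε}) := by
  set n := Module.finrank ℝ E
  set S := K ∩ {x | k < ℓ x ∧ ℓ x < k + ε}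
  set T := K ∩ {x | k - ε < ℓ x ∧ ℓ x < k}
  set m := k - ℓ p with hm
  have hm1 : 1 ≤ m := by linarith
  set ρ := m / (m + ε) with hρ
  have hρ0 : 0 < ρ := by positivity
  have hρ1 : ρ ≤ 1 := (div_le_one (by positivity)).2 (by linarith)
  have hρm : ρ * (m + ε) = m := div_mul_cancel₀ _ (by positivity)
  have hρε : 1 - ε ≤ ρ := by
    rw [hρ, le_div_iff₀ (by positivity)]; nlinarith
  have hsub : AffineMap.homothety p ρ '' S ⊆ T := by
    rintro _ ⟨x, ⟨hxK, hx1, hx2⟩, rfl⟩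
    have hx : AffineMap.homothety p ρ x = (1 - ρ) • p + ρ • x := by
      rw [AffineMap.homothety_apply, vsub_eq_sub, vadd_eq_add]; module
    have hℓ : ℓ (AffineMap.homothety p ρ x) = ℓ p + ρ * (ℓ x - ℓ p) := by
      rw [hx, map_add, map_smul, map_smul, smul_eq_mul, smul_eq_mul]; ring
    refine ⟨?_, ?_, ?_⟩
    · rw [hx]; exact hconv hp hxK (by linarith) hρ0.le (by ring)
    · rw [hℓ]
      have h1 : ρ * m < ρ * (ℓ x - ℓ p) := mul_lt_mul_of_pos_left (by linarith) hρ0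
      nlinarith
    · rw [hℓ]
      have h1 : ρ * (ℓ x - ℓ p) < ρ * (m + ε) := mul_lt_mul_of_pos_left (by linarith) hρ0
      linarith
  have hTfin : μ T ≠ ∞ := ((measure_mono inter_subset_left).trans_lt hK.measure_lt_top).ne
  have h1 : ρ ^ n * μ.real S ≤ μ.real T := by
    have h2 := measureReal_mono hsub hTfin
    rw [measureReal_def, Measure.addHaar_image_homothety, ENNReal.toReal_mul,
      ENNReal.toReal_ofReal (abs_nonneg _), abs_of_nonneg (by positivity)] at h2
    exact h2
  have h2 : 1 - n * ε ≤ ρ ^ n := by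
    have h3 := one_add_mul_le_pow (a := -ε) (by linarith) n
    refine le_trans (by linarith) (h3.trans ?_)
    exact pow_le_pow_left₀ (by linarith) (by linarith) n
  have h3 : (1 - n * ε) * μ.real S ≤ ρ ^ n * μ.real S :=
    mul_le_mul_of_nonneg_right h2 measureReal_nonneg
  linarith

/-- If a convex body meets the sets periodic along an integral functional in the same volume as
their reflections, then its top cap is asymptotically not larger than its bottom cap. -/
theorem capLE_of_measure_inter_eq {K : Set E} (hK : IsCompact K) (hconv : Convex ℝ K)
    {ℓ : E →L[ℝ] ℝ} (hℓ : ℓ ≠ 0) {lo hi : ℤ} (hbd : ∀ x ∈ K, (lo : ℝ) ≤ ℓ x ∧ ℓ x ≤ hi)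
    (hlo : ∃ x ∈ K, ℓ x = lo)
    (hper : ∀ W : Set ℝ, MeasurableSet W → (∀ (k : ℤ) (x : ℝ), k + x ∈ W ↔ x ∈ W) →
      μ (K ∩ ℓ ⁻¹' W) = μ (K ∩ ℓ ⁻¹' (-W))) :
    CapLE μ K ℓ lo hi := by
  obtain ⟨p, hp, hpl⟩ := hlo
  have hfin : ∀ S : Set E, μ (K ∩ S) ≠ ∞ := fun S =>
    ((measure_mono inter_subset_left).trans_lt hK.measure_lt_top).ne
  have hlohi : lo ≤ hi := by
    have := hbd p hp
    exact_mod_cast this.1.trans this.2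
  let up : ℤ → ℝ → Set E := fun k s => K ∩ {x | (k : ℝ) - s < ℓ x ∧ ℓ x < k}
  let dn : ℤ → ℝ → Set E := fun k s => K ∩ {x | (k : ℝ) < ℓ x ∧ ℓ x < k + s}
  have hmeas : ∀ k s, MeasurableSet (up k s) := fun k s => hK.measurableSet.inter <|
    (measurableSet_lt measurable_const ℓ.measurable).inter
      (measurableSet_lt ℓ.measurable measurable_const)
  have hsum : ∀ s ∈ Ioo (0 : ℝ) 1, ∑ k ∈ Finset.Ioc lo hi, μ.real (up k s) ≤
      ∑ k ∈ Finset.Ico lo hi, μ.real (dn k s) := by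
    intro s hs
    let W : Set ℝ := {t | 1 - s < Int.fract t}
    have hW : MeasurableSet W := measurableSet_lt measurable_const measurable_fract
    have hWper : ∀ (k : ℤ) x, (k : ℝ) + x ∈ W ↔ x ∈ W := fun k x => by
      simp only [W, Set.mem_ofPred_eq, Int.fract_intCast_add]
    have hdisj : (↑(Finset.Ioc lo hi) : Set ℤ).PairwiseDisjoint (fun k => up k s) := by
      intro i _ j _ hij
      refine Set.disjoint_left.2 fun x hx hy => hij ?_
      have h1 := hx.2; have h2 := hy.2
      simp only [Set.mem_ofPred_eq] at h1 h2
      have h3 : (i : ℝ) < j + 1 := by linarith [hs.2]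
      have h4 : (j : ℝ) < i + 1 := by linarith [hs.2]
      have h5 : i < j + 1 := by exact_mod_cast h3
      have h6 : j < i + 1 := by exact_mod_cast h4
      omega
    rw [← measureReal_biUnion_finset hdisj (fun k _ => hmeas k s) fun k _ => hfin _]
    calc μ.real (⋃ k ∈ Finset.Ioc lo hi, up k s) ≤ μ.real (K ∩ ℓ ⁻¹' W) := by
          refine measureReal_mono (iUnion₂_subset fun k _ x hx => ⟨hx.1, ?_⟩) (hfin _)
          obtain ⟨-, hx1, hx2⟩ := hx
          have h1 : ⌊ℓ x⌋ = k - 1 := Int.floor_eq_iff.2 ⟨by push_cast; linarith [hs.2],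
            by push_cast; linarith⟩
          change 1 - s < ℓ x - ⌊ℓ x⌋
          rw [h1]; push_cast; linarith
      _ = μ.real (K ∩ ℓ ⁻¹' (-W)) := by rw [measureReal_def, measureReal_def, hper W hW hWper]
      _ ≤ μ.real (⋃ k ∈ Finset.Ico lo hi, dn k s) := by
          refine measureReal_mono ?_
            (((measure_mono (iUnion₂_subset fun k _ => inter_subset_left)).trans_lt
              hK.measure_lt_top).ne)
          rintro x ⟨hxK, hx⟩
          change 1 - s < -ℓ x - ⌊-ℓ x⌋ at hx
          have h1 := Int.lt_floor_add_one (-ℓ x)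
          have h2 := hbd x hxK
          refine mem_iUnion₂.2 ⟨-⌊-ℓ x⌋ - 1, Finset.mem_Ico.2 ⟨?_, ?_⟩, hxK, ?_, ?_⟩
          · have : ((⌊-ℓ x⌋ : ℤ) : ℝ) < ((-lo : ℤ) : ℝ) := by push_cast; linarith [hs.2]
            have := Int.cast_lt.1 this
            omega
          · have : ((-hi : ℤ) : ℝ) < ((⌊-ℓ x⌋ + 1 : ℤ) : ℝ) := by push_cast; linarith [hs.2]
            have := Int.cast_lt.1 this
            omega
          · push_cast; linarith
          · push_cast; linarith
      _ ≤ _ := measureReal_biUnion_finset_le _ _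
  have hcap : ∀ s, μ.real (K ∩ {x | (hi : ℝ) - s < ℓ x}) ≤ μ.real (up hi s) := by
    intro s
    have h0 : μ.real {x | ℓ x = hi} = 0 := by
      rw [measureReal_def, measure_levelSet_eq_zero μ hℓ, ENNReal.toReal_zero]
    have hsub : K ∩ {x | (hi : ℝ) - s < ℓ x} ⊆ up hi s ∪ {x | ℓ x = hi} := by
      rintro x ⟨hxK, hx⟩
      rcases (hbd x hxK).2.lt_or_eq with h | h
      · exact Or.inl ⟨hxK, hx, h⟩
      · exact Or.inr h
    calc _ ≤ μ.real (up hi s ∪ {x | ℓ x = hi}) := by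
          refine measureReal_mono hsub (measure_union_lt_top (lt_top_iff_ne_top.2 (hfin _)) ?_).ne
          rw [measure_levelSet_eq_zero μ hℓ]; exact ENNReal.zero_lt_top
      _ ≤ _ := measureReal_union_le _ _
      _ = _ := by rw [h0, add_zero]
  have hdn : ∀ s, μ.real (dn lo s) ≤ μ.real (K ∩ {x | ℓ x < lo + s}) := fun s =>
    measureReal_mono (inter_subset_inter_right _ fun x hx => hx.2) (hfin _)
  rcases hlohi.eq_or_lt with rfl | hlt
  · intro η hη
    filter_upwards [Ioo_mem_nhdsGT (zero_lt_one (α := ℝ))] with s hs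
    have h1 : μ.real (up lo s) = 0 := by
      have : up lo s = ∅ := by
        refine Set.eq_empty_of_forall_notMem fun x hx => ?_
        exact absurd hx.2.2 (not_lt.2 (hbd x hx.1).1)
      rw [this, measureReal_empty]
    have h2 := hcap s
    have h3 : 0 ≤ η * s := mul_nonneg hη.le hs.1.le
    have h4 : 0 ≤ μ.real (K ∩ {x | ℓ x < lo + s}) := measureReal_nonneg
    linarith
  intro η hη
  set n := (Module.finrank ℝ E : ℝ)
  have htend : Tendsto (fun s => ∑ k ∈ Finset.Ioo lo hi, n * μ.real (dn k s)) (𝓝[>] 0) (𝓝 0) := by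
    rw [show 𝓝 (0 : ℝ) = 𝓝 (∑ k ∈ Finset.Ioo lo hi, n * 0) by simp]
    refine tendsto_finsetSum _ fun k _ => Tendsto.const_mul _ ?_
    have h1 := tendsto_measure_inter_slab μ hK (neg_ne_zero.2 hℓ) (-k : ℝ)
    have h2 := (ENNReal.tendsto_toReal ENNReal.zero_ne_top).comp h1
    refine squeeze_zero (fun s => measureReal_nonneg) (fun s => ?_) h2
    refine measureReal_mono (inter_subset_inter_right _ fun x hx => ?_) (hfin _)
    have h3 : (-ℓ) x = -ℓ x := rfl
    simp only [Set.mem_ofPred_eq, h3] at hx ⊢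
    constructor <;> linarith [hx.1, hx.2]
  filter_upwards [Ioo_mem_nhdsGT (zero_lt_one (α := ℝ)), htend.eventually (gt_mem_nhds hη)]
    with s hs hsη
  have h1 := hsum s hs
  rw [← Finset.Ioo_insert_right hlt, ← Finset.Ioo_insert_left hlt,
    Finset.sum_insert (by simp), Finset.sum_insert (by simp)] at h1
  have h2 : ∑ k ∈ Finset.Ioo lo hi, μ.real (dn k s) ≤ ∑ k ∈ Finset.Ioo lo hi, μ.real (up k s) +
      (∑ k ∈ Finset.Ioo lo hi, n * μ.real (dn k s)) * s := by
    rw [Finset.sum_mul, ← Finset.sum_add_distrib]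
    refine Finset.sum_le_sum fun k hk => ?_
    have hk1 : ((lo + 1 : ℤ) : ℝ) ≤ k := by
      exact_mod_cast (Finset.mem_Ioo.1 hk).1
    have := measureReal_slab_above_le μ hK hconv hp (k := k) (by rw [hpl]; exact_mod_cast hk1)
      hs.1 hs.2
    calc _ ≤ _ := this
      _ = _ := by ring
  have h3 := mul_le_mul_of_nonneg_right hsη.le hs.1.le
  linarith [hcap s, hdn s]

end Periodic

section HalfSpaces

/-- Eliminating a nonnegative multiple of a vector from a system of linear inequalities. -/
lemma exists_forall_sub_smul_nonpos {X : Type*} [AddCommGroup X] [Module ℝ X]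
    (A : Finset (X →ₗ[ℝ] ℝ)) {w y : X} (h₁ : ∀ f ∈ A, f w ≤ 0 → f y ≤ 0)
    (h₂ : ∀ f ∈ A, ∀ f' ∈ A, 0 < f w → f' w < 0 → f w * f' y - f' w * f y ≤ 0) :
    ∃ t : ℝ, 0 ≤ t ∧ ∀ f ∈ A, f (y - t • w) ≤ 0 := by
  classical
  by_cases hne : (A.filter fun f => 0 < f w).Nonempty
  · obtain ⟨f₀, hf₀, hmax⟩ := Finset.exists_max_image _ (fun f => f y / f w) hne
    obtain ⟨hf₀A, hf₀w⟩ := Finset.mem_filter.1 hf₀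
    refine ⟨max 0 (f₀ y / f₀ w), le_max_left _ _, fun f hf => ?_⟩
    rw [map_sub, map_smul, smul_eq_mul]
    rcases lt_trichotomy (f w) 0 with h | h | h
    · have h3 : max 0 (f₀ y / f₀ w) ≤ f y / f w := by
        refine max_le (div_nonneg_of_nonpos (h₁ f hf h.le) h.le) ?_
        have := h₂ f₀ hf₀A f hf hf₀w h
        rw [le_div_iff_of_neg h, div_mul_eq_mul_div, le_div_iff₀ hf₀w]
        linarith
      have := (le_div_iff_of_neg h).1 h3
      linarith
    · rw [h, mul_zero, sub_zero]; exact h₁ f hf h.le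
    · have h3 := (hmax f (Finset.mem_filter.2 ⟨hf, h⟩)).trans (le_max_right 0 (f₀ y / f₀ w))
      have := (div_le_iff₀ h).1 h3
      linarith
  · refine ⟨0, le_rfl, fun f hf => ?_⟩
    rw [zero_smul, sub_zero]
    exact h₁ f hf (not_lt.1 fun h => hne ⟨f, Finset.mem_filter.2 ⟨hf, h⟩⟩)

/-- A cone generated by finitely many integral vectors is cut out by finitely many integral
linear inequalities. -/
theorem exists_finset_cone_iff {X ι : Type*} [AddCommGroup X] [Module ℝ X] [DecidableEq ι]
    (M : Set X) (φ : ι → X) (A₀ : Finset (X →ₗ[ℝ] ℝ))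
    (hA₀ : ∀ f ∈ A₀, ∀ m ∈ M, ∃ k : ℤ, f m = k) (hsep : ∀ x, (∀ f ∈ A₀, f x ≤ 0) → x = 0)
    (s : Finset ι) (hφ : ∀ i ∈ s, φ i ∈ M) :
    ∃ A : Finset (X →ₗ[ℝ] ℝ), (∀ f ∈ A, ∀ m ∈ M, ∃ k : ℤ, f m = k) ∧
      ∀ x, (∃ c : ι → ℝ, (∀ i ∈ s, 0 ≤ c i) ∧ ∑ i ∈ s, c i • φ i = x) ↔ ∀ f ∈ A, f x ≤ 0 := by
  classical
  induction s using Finset.induction_on with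
  | empty =>
    refine ⟨A₀, hA₀, fun x => ⟨?_, fun h => ⟨0, by simp, by simp [hsep x h]⟩⟩⟩
    rintro ⟨c, -, rfl⟩
    simp
  | insert j s hj ih =>
    obtain ⟨A, hA, hiff⟩ := ih fun i hi => hφ i (Finset.mem_insert_of_mem hi)
    have hjM := hφ j (Finset.mem_insert_self _ _)
    set w := φ j
    refine ⟨(A.filter fun f => f w ≤ 0) ∪
      (((A ×ˢ A).filter fun p => 0 < p.1 w ∧ p.2 w < 0).image
        fun p => p.1 w • p.2 - p.2 w • p.1), ?_, fun x => ⟨?_, fun h => ?_⟩⟩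
    · intro f hf m hm
      rcases Finset.mem_union.1 hf with hf | hf
      · exact hA f (Finset.mem_filter.1 hf).1 m hm
      · obtain ⟨p, hp, rfl⟩ := Finset.mem_image.1 hf
        obtain ⟨hpA, -⟩ := Finset.mem_filter.1 hp
        obtain ⟨hp1, hp2⟩ := Finset.mem_product.1 hpA
        obtain ⟨a, ha⟩ := hA _ hp1 m hm
        obtain ⟨b, hb⟩ := hA _ hp2 m hm
        obtain ⟨a', ha'⟩ := hA _ hp1 w hjM
        obtain ⟨b', hb'⟩ := hA _ hp2 w hjM
        refine ⟨a' * b - b' * a, ?_⟩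
        simp [ha, hb, ha', hb']
    · rintro ⟨c, hc, rfl⟩
      have hcj := hc j (Finset.mem_insert_self _ _)
      rw [Finset.sum_insert hj]
      have hC := (hiff (∑ i ∈ s, c i • φ i)).1
        ⟨c, fun i hi => hc i (Finset.mem_insert_of_mem hi), rfl⟩
      set z := ∑ i ∈ s, c i • φ i
      intro f hf
      rcases Finset.mem_union.1 hf with hf | hf
      · obtain ⟨hfA, hfw⟩ := Finset.mem_filter.1 hf
        have := hC f hfA
        rw [map_add, map_smul, smul_eq_mul]
        nlinarith
      · obtain ⟨p, hp, rfl⟩ := Finset.mem_image.1 hf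
        obtain ⟨hpA, hp3, hp4⟩ := Finset.mem_filter.1 hp
        obtain ⟨hp1, hp2⟩ := Finset.mem_product.1 hpA
        have h1 := hC _ hp1
        have h2 := hC _ hp2
        simp only [LinearMap.sub_apply, LinearMap.smul_apply, map_add, map_smul, smul_eq_mul]
        change c j * (p.1 w * p.2 w - p.2 w * p.1 w) + (p.1 w * p.2 z - p.2 w * p.1 z) ≤ 0
        nlinarith
    · obtain ⟨t, ht, hty⟩ := exists_forall_sub_smul_nonpos A (w := w) (y := x)
        (fun f hf hfw => h f (Finset.mem_union_left _ (Finset.mem_filter.2 ⟨hf, hfw⟩)))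
        (fun f hf f' hf' hfw hfw' => h (f w • f' - f' w • f) (Finset.mem_union_right _
          (Finset.mem_image.2 ⟨(f, f'), Finset.mem_filter.2
            ⟨Finset.mem_product.2 ⟨hf, hf'⟩, hfw, hfw'⟩, rfl⟩)))
      obtain ⟨c, hc, hcx⟩ := (hiff _).2 hty
      refine ⟨Function.update c j t, fun i hi => ?_, ?_⟩
      · rcases eq_or_ne i j with rfl | hij
        · rwa [Function.update_self]
        · rw [Function.update_of_ne hij]
          exact hc i (Finset.mem_of_mem_insert_of_ne hi hij)
      · rw [Finset.sum_insert hj, Function.update_self]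
        have : ∑ i ∈ s, Function.update c j t i • φ i = ∑ i ∈ s, c i • φ i :=
          Finset.sum_congr rfl fun i hi => by
            rw [Function.update_of_ne (ne_of_mem_of_not_mem hi hj)]
        rw [this, hcx]
        change t • w + (x - t • w) = x
        abel

/-- A lattice polytope is cut out by finitely many integral supporting half-spaces. -/
theorem exists_finset_forall_le_imp_mem_convexHull {E : Type*} [NormedAddCommGroup E]
    [NormedSpace ℝ E] [FiniteDimensional ℝ E] (L : Submodule ℤ E) [DiscreteTopology L]
    [IsZLattice ℝ L] (V : Finset E) (hV : ∀ v ∈ V, v ∈ L) :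
    ∃ A : Finset (E →L[ℝ] ℝ), (∀ f ∈ A, ∀ g ∈ L, ∃ k : ℤ, f g = k) ∧
      ∀ x, (∀ f ∈ A, ∃ v ∈ V, f x ≤ f v) → x ∈ convexHull ℝ (V : Set E) := by
  classical
  let b := Module.Free.chooseBasis ℤ L
  let B := b.ofZLatticeBasis ℝ
  let M : Set (E × ℝ) := {p | p.1 ∈ L ∧ ∃ k : ℤ, p.2 = k}
  let co : Module.Free.ChooseBasisIndex ℤ L → (E × ℝ →ₗ[ℝ] ℝ) :=
    fun i => (B.coord i).comp (LinearMap.fst ℝ E ℝ)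
  have hco : ∀ i, ∀ m ∈ M, ∃ k : ℤ, co i m = k := fun i m hm =>
    ⟨b.repr ⟨m.1, hm.1⟩ i, b.ofZLatticeBasis_repr_apply ℝ L ⟨m.1, hm.1⟩ i⟩
  let A₀ : Finset (E × ℝ →ₗ[ℝ] ℝ) := (Finset.univ.image co ∪ Finset.univ.image fun i => -co i) ∪
    {LinearMap.snd ℝ E ℝ, -LinearMap.snd ℝ E ℝ}
  have hA₀ : ∀ f ∈ A₀, ∀ m ∈ M, ∃ k : ℤ, f m = k := by
    intro f hf m hm
    simp only [A₀, Finset.mem_union, Finset.mem_image, Finset.mem_univ, true_and,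
      Finset.mem_insert, Finset.mem_singleton] at hf
    rcases hf with (⟨i, rfl⟩ | ⟨i, rfl⟩) | rfl | rfl
    · exact hco i m hm
    · obtain ⟨k, hk⟩ := hco i m hm
      exact ⟨-k, by rw [LinearMap.neg_apply, hk]; push_cast; rfl⟩
    · exact hm.2
    · obtain ⟨k, hk⟩ := hm.2
      exact ⟨-k, by rw [LinearMap.neg_apply, LinearMap.snd_apply, hk]; push_cast; rfl⟩
  have hsep : ∀ x, (∀ f ∈ A₀, f x ≤ 0) → x = 0 := by
    intro x hx
    simp only [A₀, Finset.mem_union, Finset.mem_image, Finset.mem_univ, true_and,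
      Finset.mem_insert, Finset.mem_singleton] at hx
    have h1 : x.1 = 0 := by
      refine B.ext_elem fun i => ?_
      have h3 : B.repr x.1 i ≤ 0 := hx (co i) (Or.inl (Or.inl ⟨i, rfl⟩))
      have h4 : -(B.repr x.1 i) ≤ 0 := hx (-co i) (Or.inl (Or.inr ⟨i, rfl⟩))
      simp only [map_zero, Finsupp.coe_zero, Pi.zero_apply]
      linarith
    have h2 : x.2 = 0 := by
      have h3 : x.2 ≤ 0 := hx (LinearMap.snd ℝ E ℝ) (Or.inr (Or.inl rfl))
      have h4 : -x.2 ≤ 0 := hx (-LinearMap.snd ℝ E ℝ) (Or.inr (Or.inr rfl))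
      linarith
    exact Prod.ext h1 h2
  obtain ⟨A, hA, hiff⟩ := exists_finset_cone_iff M (fun v : E => (v, (1 : ℝ))) A₀ hA₀ hsep V
    fun v hv => ⟨hV v hv, 1, by simp⟩
  refine ⟨A.image fun f => LinearMap.toContinuousLinearMap (f.comp (LinearMap.inl ℝ E ℝ)),
    ?_, fun x hx => ?_⟩
  · intro f hf g hg
    obtain ⟨f', hf', rfl⟩ := Finset.mem_image.1 hf
    exact hA f' hf' (g, 0) ⟨hg, 0, by simp⟩
  · obtain ⟨c, hc, hcx⟩ := (hiff (x, 1)).2 fun f hf => by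
      obtain ⟨v, hv, hxv⟩ := hx _ (Finset.mem_image_of_mem _ hf)
      have h1 : f (v, 1) ≤ 0 := (hiff (v, 1)).1 ⟨Pi.single v 1, fun i _ => by
        rw [Pi.single_apply]; split_ifs <;> norm_num, by simp [Pi.single_apply, hv]⟩ f hf
      have h2 : ∀ y : E, f (y, 1) = f (y, 0) + f (0, 1) := fun y => by
        rw [← map_add, Prod.mk_add_mk, add_zero, zero_add]
      have h3 : f (x, 0) ≤ f (v, 0) := hxv
      rw [h2] at h1 ⊢
      linarith
    rw [Finset.mem_convexHull']
    refine ⟨c, hc, ?_, ?_⟩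
    · simpa [Prod.snd_sum] using congrArg Prod.snd hcx
    · simpa [Prod.fst_sum] using congrArg Prod.fst hcx

end HalfSpaces

section LatticePolytope

variable {E : Type*} [NormedAddCommGroup E] [NormedSpace ℝ E] [FiniteDimensional ℝ E]
  [MeasurableSpace E] [BorelSpace E] (μ : Measure E) [μ.IsAddHaarMeasure]

/-- A full-dimensional lattice polytope, almost every translate of which has as many lattice points
as its mirror translate, is centrally symmetric. -/
theorem exists_sub_mem_convexHull_of_ae_tsum_eq (L : Submodule ℤ E) [DiscreteTopology L]
    [IsZLattice ℝ L] (V : Finset E) (hV : ∀ v ∈ V, v ∈ L)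
    (hint : (interior (convexHull ℝ (V : Set E))).Nonempty)
    (hcount : ∀ᵐ c ∂μ,
      ∑' g : L, (convexHull ℝ (V : Set E)).indicator (1 : E → ℝ≥0∞) (g - c) =
        ∑' g : L, (convexHull ℝ (V : Set E)).indicator (1 : E → ℝ≥0∞) (g + c)) :
    ∃ w : E, ∀ x ∈ convexHull ℝ (V : Set E), w - x ∈ convexHull ℝ (V : Set E) := by
  set K := convexHull ℝ (V : Set E)
  have hK : IsCompact K := V.finite_toSet.isCompact_convexHull ℝ
  have hconv : Convex ℝ K := convex_convexHull ℝ _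
  have hVne : V.Nonempty := by
    rw [Finset.nonempty_iff_ne_empty]
    rintro rfl
    simp [K] at hint
  have hVK : ∀ v ∈ V, v ∈ K := fun v hv => subset_convexHull ℝ _ hv
  have hmax : ∀ a : E →L[ℝ] ℝ, ∃ v ∈ V, ∀ x ∈ K, a x ≤ a v := by
    intro a
    obtain ⟨v, hv, hmax⟩ := V.exists_max_image a hVne
    refine ⟨v, hv, fun x hx => ?_⟩
    have : K ⊆ {x | a x ≤ a v} :=
      convexHull_min (fun u hu => hmax u hu) (convex_halfSpace_le a.toLinearMap.isLinear _)
    exact this hx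
  obtain ⟨A, hA, hAK⟩ := exists_finset_forall_le_imp_mem_convexHull L V hV
  choose m hmV hm using hmax
  refine exists_sub_mem_of_capLE μ A (fun a => a (m a)) hK hconv hint ?_ fun a ha ha0 => ?_
  · ext x
    exact ⟨fun hx a _ => hm a x hx, fun hx => hAK x fun a ha => ⟨m a, hmV a, hx a ha⟩⟩
  obtain ⟨hi, hhi⟩ := hA a ha _ (hV _ (hmV a))
  obtain ⟨lo, hlo⟩ := hA a ha _ (hV _ (hmV (-a)))
  have hbd : ∀ x ∈ K, (lo : ℝ) ≤ a x ∧ a x ≤ hi := fun x hx => by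
    have h1 : -a x ≤ -a (m (-a)) := hm (-a) x hx
    exact ⟨by rw [← hlo]; linarith, by rw [← hhi]; exact hm a x hx⟩
  refine ⟨lo, hi, hbd, ⟨_, hVK _ (hmV (-a)), hlo⟩, ⟨_, hVK _ (hmV a), hhi⟩,
    capLE_of_measure_inter_eq μ hK hconv ha0 hbd ⟨_, hVK _ (hmV (-a)), hlo⟩ fun W hW hWper => ?_⟩
  have hneg : a ⁻¹' (-W) = -(a ⁻¹' W) := by
    ext x; simp
  rw [hneg]
  refine measure_inter_eq_measure_inter_neg μ L hK.measurableSet (a.measurable hW)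
    (fun g x => ?_) hcount
  obtain ⟨k, hk⟩ := hA a ha g g.2
  rw [Set.mem_preimage, Set.mem_preimage, map_add, hk, hWper]

end LatticePolytope

section LatticePointCounts

variable {E : Type*} [NormedAddCommGroup E] [NormedSpace ℝ E] [FiniteDimensional ℝ E]

/-- A bounded set has finitely many lattice points. -/
lemma finite_setOf_mem_lattice (L : Submodule ℤ E) [DiscreteTopology L] {B : Set E}
    (hB : Bornology.IsBounded B) : {g : L | (g : E) ∈ B}.Finite := by
  have hcl : IsClosed (L : Set E) :=
    @AddSubgroup.isClosed_of_discrete _ _ _ _ _ L.toAddSubgroup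
      (inferInstanceAs (DiscreteTopology L))
  have h := Metric.finite_isBounded_inter_isClosed
    (DiscreteTopology.isDiscrete (s := (L : Set E))) hB hcl
  refine (h.preimage (f := ((↑) : L → E)) Subtype.val_injective.injOn).subset fun g hg => ?_
  exact ⟨hg, g.2⟩

/-- The lattice points of a translate do not change near a translation vector for which no lattice
point lies on the boundary. -/
lemma eventually_setOf_sub_mem_eq (L : Submodule ℤ E) [DiscreteTopology L] {K : Set E}
    (hK : Bornology.IsBounded K) {c : E} (hc : ∀ g : L, (g : E) - c ∉ frontier K) :
    ∀ᶠ c' in 𝓝 c, {g : L | (g : E) - c' ∈ K} = {g : L | (g : E) - c ∈ K} := by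
  have hfin := finite_setOf_mem_lattice L (hK.add (Metric.isBounded_ball (x := c) (r := 1)))
  have h1 : ∀ᶠ c' in 𝓝 c, ∀ g ∈ {g : L | (g : E) ∈ K + Metric.ball c 1},
      ((g : E) - c' ∈ K ↔ (g : E) - c ∈ K) := by
    rw [eventually_all_finite hfin]
    intro g _
    have hcont : Tendsto (fun c' => (g : E) - c') (𝓝 c) (𝓝 ((g : E) - c)) :=
      (continuous_const.sub continuous_id).tendsto c
    by_cases hg : (g : E) - c ∈ K
    · have : (g : E) - c ∈ interior K := by
        by_contra h
        exact hc g ⟨subset_closure hg, h⟩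
      filter_upwards [hcont (isOpen_interior.mem_nhds this)] with c' hc'
      exact iff_of_true (interior_subset hc') hg
    · have : (g : E) - c ∈ (closure K)ᶜ := fun h =>
        hc g ⟨h, fun h' => hg (interior_subset h')⟩
      filter_upwards [hcont (isClosed_closure.isOpen_compl.mem_nhds this)] with c' hc'
      exact iff_of_false (fun h => hc' (subset_closure h)) hg
  filter_upwards [h1, Metric.ball_mem_nhds c one_pos] with c' h2 hc'
  ext g
  constructor
  · intro hg
    exact (h2 g ⟨_, hg, c', hc', sub_add_cancel _ _⟩).1 hg
  · intro hg
    exact (h2 g ⟨_, hg, c, Metric.mem_ball_self one_pos, sub_add_cancel _ _⟩).2 hg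

/-- Almost every translate of a convex set has no lattice point on its boundary. -/
lemma ae_forall_sub_notMem_frontier [MeasurableSpace E] [BorelSpace E] (μ : Measure E)
    [μ.IsAddHaarMeasure] (L : Submodule ℤ E) [Countable L] {K : Set E}
    (hK : Convex ℝ K) : ∀ᵐ c ∂μ, ∀ g : L, (g : E) - c ∉ frontier K := by
  rw [ae_all_iff]
  intro g
  have h1 : μ ((fun c => (g : E) - c) ⁻¹' frontier K) = 0 :=
    (Measure.measurePreserving_sub_left μ (g : E)).quasiMeasurePreserving.preimage_null
      (hK.addHaar_frontier μ)
  exact measure_eq_zero_iff_ae_notMem.1 h1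

lemma tsum_indicator_eq_ncard (L : Submodule ℤ E) [DiscreteTopology L] {K : Set E}
    (hK : Bornology.IsBounded K) (c : E) :
    ∑' g : L, K.indicator (1 : E → ℝ≥0∞) (g - c) = ({g : L | (g : E) - c ∈ K}.ncard : ℝ≥0∞) := by
  have hfin : {g : L | (g : E) - c ∈ K}.Finite :=
    (finite_setOf_mem_lattice L (hK.add (Bornology.isBounded_singleton (x := c)))).subset
      fun g hg => ⟨_, hg, c, rfl, sub_add_cancel _ _⟩
  have h1 : ∀ g : L, K.indicator (1 : E → ℝ≥0∞) (g - c) =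
      {g : L | (g : E) - c ∈ K}.indicator 1 g := fun g => by
    by_cases h : (g : E) - c ∈ K
    · rw [indicator_of_mem h, indicator_of_mem (by exact h)]; rfl
    · rw [indicator_of_notMem h, indicator_of_notMem (by exact h)]
  simp_rw [h1]
  rw [← tsum_subtype]
  have h2 : ∑' g : {g : L | (g : E) - c ∈ K}, (1 : L → ℝ≥0∞) g =
      ∑' _ : {g : L | (g : E) - c ∈ K}, (1 : ℝ≥0∞) := rfl
  rw [h2, ENNReal.tsum_set_one, ← hfin.cast_ncard_eq]
  rfl

/-- If a full-dimensional lattice polytope is not centrally symmetric, then the numbers of lattice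
points of mirror translates differ for an open set of translation vectors. -/
theorem exists_isOpen_ncard_ne (L : Submodule ℤ E) [DiscreteTopology L]
    [IsZLattice ℝ L] (V : Finset E) (hV : ∀ v ∈ V, v ∈ L)
    (hint : (interior (convexHull ℝ (V : Set E))).Nonempty)
    (hns : ¬ ∃ w : E, ∀ x ∈ convexHull ℝ (V : Set E), w - x ∈ convexHull ℝ (V : Set E)) :
    ∃ U : Set E, IsOpen U ∧ U.Nonempty ∧ ∀ c ∈ U,
      {g : L | (g : E) - c ∈ convexHull ℝ (V : Set E)}.ncard ≠
        {g : L | (g : E) - -c ∈ convexHull ℝ (V : Set E)}.ncard := by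
  set K := convexHull ℝ (V : Set E)
  have hK : Bornology.IsBounded K := (V.finite_toSet.isCompact_convexHull ℝ).isBounded
  have hconv : Convex ℝ K := convex_convexHull ℝ _
  borelize E
  obtain ⟨μ, _⟩ : ∃ μ : Measure E, μ.IsAddHaarMeasure := ⟨Measure.addHaar, inferInstance⟩
  by_contra! hU
  have hgen := ae_forall_sub_notMem_frontier μ L hconv
  have hgen' : ∀ᵐ c ∂μ, ∀ g : L, (g : E) - -c ∉ frontier K :=
    (Measure.measurePreserving_neg μ).quasiMeasurePreserving.ae hgen
  have hcard : ∀ᵐ c ∂μ, {g : L | (g : E) - c ∈ K}.ncard = {g : L | (g : E) - -c ∈ K}.ncard := by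
    filter_upwards [hgen, hgen'] with c hc hc'
    have h1 := eventually_setOf_sub_mem_eq L hK hc
    have h2 := (continuous_neg.tendsto c).eventually (eventually_setOf_sub_mem_eq L hK hc')
    obtain ⟨U, hUsub, hUo, hcU⟩ := eventually_nhds_iff.1 (h1.and h2)
    obtain ⟨x, hxU, hx⟩ := hU U hUo ⟨c, hcU⟩
    obtain ⟨h3, h4⟩ := hUsub x hxU
    rwa [h3, h4] at hx
  have hcount : ∀ᵐ c ∂μ, ∑' g : L, K.indicator (1 : E → ℝ≥0∞) (g - c) =
      ∑' g : L, K.indicator (1 : E → ℝ≥0∞) (g + c) := by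
    filter_upwards [hcard] with c hc
    simp_rw [← sub_neg_eq_add _ c]
    rw [tsum_indicator_eq_ncard L hK, tsum_indicator_eq_ncard L hK, hc]
  exact hns (exists_sub_mem_convexHull_of_ae_tsum_eq μ L V hV hint hcount)

end LatticePointCounts

lemma castVec_injective {d : ℕ} : Function.Injective (castVec (d := d)) := fun _ _ h =>
  funext fun i => Int.cast_injective (congrFun h i)

/-- The integer points of a linear subspace. -/
def integerPoints {d : ℕ} (E : Submodule ℝ (Fin d → ℝ)) : Submodule ℤ E :=
  ZLattice.comap ℝ (Submodule.span ℤ (Set.range (Pi.basisFun ℝ (Fin d)))) E.subtype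

instance {d : ℕ} (E : Submodule ℝ (Fin d → ℝ)) : DiscreteTopology (integerPoints E) :=
  ZLattice.comap_discreteTopology ℝ _ E.subtypeL.continuous E.injective_subtype

lemma mem_integerPoints {d : ℕ} {E : Submodule ℝ (Fin d → ℝ)} {y : E} :
    y ∈ integerPoints E ↔ ∃ x : Fin d → ℤ, castVec x = y := by
  change (y : Fin d → ℝ) ∈ Submodule.span ℤ (Set.range (Pi.basisFun ℝ (Fin d))) ↔ _
  rw [Module.Basis.mem_span_iff_repr_mem]
  simp only [Pi.basisFun_repr, Set.mem_range, algebraMap_int_eq, Int.coe_castRingHom]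
  constructor
  · intro h
    choose x hx using h
    exact ⟨x, funext hx⟩
  · rintro ⟨x, hx⟩ i
    exact ⟨x i, congrFun hx i⟩

/-- The lattice points in a translate of `p₀ + K`, counted inside the linear subspace `E`. -/
lemma latCount_vadd_image_add {d : ℕ} {E : Submodule ℝ (Fin d → ℝ)} (v₀ : Fin d → ℤ) (K : Set E)
    (c : E) : latCount ((c : Fin d → ℝ) +ᵥ (fun y : E => castVec v₀ + (y : Fin d → ℝ)) '' K) =
      {g : integerPoints E | (g : E) - c ∈ K}.ncard := by
  have hinj : Function.Injective
      (fun g : integerPoints E => castVec v₀ + ((g : E) : Fin d → ℝ)) := fun g g' h =>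
    Subtype.ext (Subtype.ext (add_left_cancel h))
  rw [latCount, ← Set.ncard_image_of_injective _ castVec_injective,
    ← Set.ncard_image_of_injective _ hinj]
  congr 1
  ext u
  constructor
  · rintro ⟨x, ⟨_, ⟨y, hy, rfl⟩, hx⟩, rfl⟩
    have hx : (c : Fin d → ℝ) + (castVec v₀ + y) = castVec x := hx
    have hg : c + y ∈ integerPoints E := mem_integerPoints.2 ⟨x - v₀, by
      have : castVec (x - v₀) = castVec x - castVec v₀ := by
        ext i; simp [castVec]
      rw [this, ← hx, Submodule.coe_add]; abel⟩
    refine ⟨⟨c + y, hg⟩, ?_, ?_⟩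
    · simpa using hy
    · rw [← hx]
      change castVec v₀ + ((c + y : E) : Fin d → ℝ) = _
      rw [Submodule.coe_add]; abel
  · rintro ⟨g, hg, rfl⟩
    obtain ⟨x, hx⟩ := mem_integerPoints.1 g.2
    have hadd : castVec (v₀ + x) = castVec v₀ + castVec x := by
      ext i; simp [castVec]
    refine ⟨v₀ + x, ⟨castVec v₀ + ((g : E) - c : E), ⟨_, hg, rfl⟩, ?_⟩, ?_⟩
    · change (c : Fin d → ℝ) + (castVec v₀ + (((g : E) - c : E) : Fin d → ℝ)) = _
      rw [hadd, hx, Submodule.coe_sub]; abel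
    · rw [hadd, hx]

/-- A lattice polytope is, up to an integral translation, a full-dimensional lattice polytope in
the linear subspace parallel to its affine hull. -/
lemma IsLatticePolytope.exists_finset_direction {d : ℕ} {P : Set (Fin d → ℝ)}
    (hP : IsLatticePolytope P) :
    ∃ (v₀ : Fin d → ℤ) (V : Finset (affineSpan ℝ P).direction),
      (∀ v ∈ V, v ∈ integerPoints (affineSpan ℝ P).direction) ∧ 0 ∈ V ∧
      Submodule.span ℝ (V : Set (affineSpan ℝ P).direction) = ⊤ ∧
      P = (fun y : (affineSpan ℝ P).direction => castVec v₀ + (y : Fin d → ℝ)) ''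
        convexHull ℝ (V : Set (affineSpan ℝ P).direction) := by
  obtain ⟨S, ⟨v₀, hv₀⟩, hPS⟩ := hP
  set E := (affineSpan ℝ P).direction with hE
  have hEspan : E = Submodule.span ℝ ((· -ᵥ castVec v₀) '' (castVec '' (S : Set (Fin d → ℤ)))) := by
    rw [hE, hPS, affineSpan_convexHull, direction_affineSpan]
    exact vectorSpan_eq_span_vsub_set_right ℝ (Set.mem_image_of_mem _ hv₀)
  let τ : E →ᵃ[ℝ] (Fin d → ℝ) := AffineMap.const ℝ E (castVec v₀) + E.subtype.toAffineMap
  have hτ : ∀ y, τ y = castVec v₀ + (y : Fin d → ℝ) := fun y => rfl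
  have hτinj : Function.Injective τ := fun y y' h => Subtype.ext (add_left_cancel h)
  have hfin : (τ ⁻¹' (castVec '' (S : Set (Fin d → ℤ)))).Finite :=
    (S.finite_toSet.image _).preimage hτinj.injOn
  have himage : τ '' (τ ⁻¹' (castVec '' (S : Set (Fin d → ℤ)))) =
      castVec '' (S : Set (Fin d → ℤ)) := by
    refine Set.image_preimage_eq_of_subset ?_
    rintro u hu
    have : u - castVec v₀ ∈ E := by
      rw [hEspan]
      exact Submodule.subset_span ⟨u, hu, rfl⟩
    exact ⟨⟨_, this⟩, add_sub_cancel _ _⟩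
  refine ⟨v₀, hfin.toFinset, ?_, ?_, ?_, ?_⟩
  · intro y hy
    obtain ⟨x, -, hx⟩ := hfin.mem_toFinset.1 hy
    refine mem_integerPoints.2 ⟨x - v₀, ?_⟩
    have : castVec (x - v₀) = castVec x - castVec v₀ := by
      ext i; simp [castVec]
    rw [this, hx, hτ]; abel
  · exact hfin.mem_toFinset.2 ⟨v₀, hv₀, by rw [hτ]; simp⟩
  · refine Submodule.map_injective_of_injective E.injective_subtype ?_
    rw [Submodule.map_span, Submodule.map_top, Submodule.range_subtype, hfin.coe_toFinset]
    conv_rhs => rw [hEspan]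
    congr 1
    conv_rhs => rw [← himage, Set.image_image]
    refine Set.image_congr fun y _ => ?_
    rw [hτ, vsub_eq_sub]; exact (add_sub_cancel_left _ _).symm
  · rw [hfin.coe_toFinset]
    change P = τ '' _
    rw [AffineMap.image_convexHull, himage, hPS]

/-- A lattice polytope that is not centrally symmetric, presented as an integral translate of a
full-dimensional polytope in a linear subspace, has different numbers of lattice points in mirror
translates for an open set of translation vectors. -/
theorem exists_isOpen_latCount_ne {d : ℕ} {E : Submodule ℝ (Fin d → ℝ)} {P : Set (Fin d → ℝ)}
    (v₀ : Fin d → ℤ) (V : Finset E) (hVL : ∀ v ∈ V, v ∈ integerPoints E) (hV0 : 0 ∈ V)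
    (hspan : Submodule.span ℝ (V : Set E) = ⊤)
    (hP : P = (fun y : E => castVec v₀ + (y : Fin d → ℝ)) '' convexHull ℝ (V : Set E))
    (hns : ¬ CentrallySymmetric P) :
    ∃ U : Set E, IsOpen U ∧ U.Nonempty ∧ ∀ c ∈ U,
      latCount ((c : Fin d → ℝ) +ᵥ P) ≠ latCount (-(c : Fin d → ℝ) +ᵥ P) := by
  subst hP
  set K := convexHull ℝ (V : Set E)
  have hL : IsZLattice ℝ (integerPoints E) :=
    ⟨top_le_iff.1 (hspan.symm.le.trans (Submodule.span_mono fun v hv => hVL v hv))⟩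
  have hint : (interior K).Nonempty := by
    rw [interior_convexHull_nonempty_iff_affineSpan_eq_top,
      ← AffineSubspace.direction_eq_top_iff_of_nonempty ⟨0, subset_affineSpan ℝ _ hV0⟩,
      direction_affineSpan, vectorSpan_eq_span_vsub_set_right ℝ (Finset.mem_coe.2 hV0)]
    simpa using hspan
  obtain ⟨U, hU, hUne, hUc⟩ := exists_isOpen_ncard_ne (integerPoints E) V hVL hint fun ⟨w, hw⟩ => by
    refine hns ⟨castVec v₀ + castVec v₀ + (w : Fin d → ℝ), Set.Subset.antisymm ?_ ?_⟩
    · intro x hx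
      obtain ⟨y, hy, rfl⟩ := hx
      refine ⟨-(castVec v₀ + ((w - y : E) : Fin d → ℝ)), ?_, ?_⟩
      · rw [Set.neg_mem_neg]
        exact ⟨_, hw y hy, rfl⟩
      · change _ + -(castVec v₀ + ((w - y : E) : Fin d → ℝ)) = castVec v₀ + (y : Fin d → ℝ)
        rw [Submodule.coe_sub]; abel
    · rintro _ ⟨x, hx, rfl⟩
      rw [Set.mem_neg] at hx
      obtain ⟨y, hy, hyx⟩ := hx
      refine ⟨_, hw y hy, ?_⟩
      have hx' : x = -(castVec v₀ + (y : Fin d → ℝ)) := by rw [← neg_neg x, ← hyx]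
      change castVec v₀ + ((w - y : E) : Fin d → ℝ) = castVec v₀ + castVec v₀ + (w : Fin d → ℝ) + x
      rw [hx', Submodule.coe_sub]; abel
  refine ⟨U, hU, hUne, fun c hc => ?_⟩
  rw [← Submodule.coe_neg, latCount_vadd_image_add, latCount_vadd_image_add]
  exact hUc c hc

/-- If a lattice polytope `P` is not centrally symmetric, then there is a
nonempty open subset `U` of `aff₀(P)` such that for every `c ∈ U` the translated
lattice point enumerators of `c` and `−c` differ. -/
theorem exists_open_set_of_not_centrally_symmetric
    (d : ℕ) (P : Set (Fin d → ℝ)) (hP : IsLatticePolytope P)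
    (hns : ¬ CentrallySymmetric P) :
    ∃ U : Set ↥((affineSpan ℝ P).direction), IsOpen U ∧ U.Nonempty ∧
      ∀ c ∈ U, ∃ t : ℕ, 0 < t ∧
        latCount ((c : Fin d → ℝ) +ᵥ (t : ℝ) • P) ≠
          latCount ((-(c : Fin d → ℝ)) +ᵥ (t : ℝ) • P) := by
  obtain ⟨v₀, V, hVL, hV0, hspan, hPV⟩ := hP.exists_finset_direction
  obtain ⟨U, hU, hUne, hUc⟩ := exists_isOpen_latCount_ne v₀ V hVL hV0 hspan hPV hns
  refine ⟨U, hU, hUne, fun c hc => ⟨1, one_pos, ?_⟩⟩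
  rw [Nat.cast_one, one_smul]
  exact hUc c hc
end
end

section
/- Let f : ℝ → ℝ be a periodic, almost locally constant function such that f(x) = f(2x) for all x outside a discrete subset of ℝ. Then f is almost constant. -/
open Pointwise MeasureTheory
open scoped RealInnerProductSpace

noncomputable section

theorem Set.Countable.of_discreteTopology {X : Type*} [TopologicalSpace X]
    [SecondCountableTopology X] {D : Set X} (hD : DiscreteTopology D) : D.Countable :=
  Set.countable_coe_iff.mp countable_of_Lindelof_of_discrete

theorem Set.Countable.preimage_add_mul_div_two_pow {C : Set ℝ} (hC : C.Countable) (p : ℝ) :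
    {x : ℝ | ∃ n k : ℕ, (x + k * p) / 2 ^ n ∈ C}.Countable := by
  have h : {x : ℝ | ∃ n k : ℕ, (x + k * p) / 2 ^ n ∈ C} =
      ⋃ (n : ℕ) (k : ℕ), (fun x : ℝ => (x + k * p) / 2 ^ n) ⁻¹' C := by
    ext x
    simp
  rw [h]
  refine Set.countable_iUnion fun n => Set.countable_iUnion fun k => ?_
  refine hC.preimage_of_injOn fun x _ y _ hxy => ?_
  have h2 : (2 : ℝ) ^ n ≠ 0 := by positivity
  simpa [div_left_inj' h2] using hxy

/-- A function that is locally constant off `D` agrees, at every point off `D`, with its values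
at the nearby points off `D`. -/
theorem IsLocallyConstant.eventually_eq_of_notMem {X Y : Type*} [TopologicalSpace X]
    {D : Set X} {f : X → Y} (hf : IsLocallyConstant fun x : ↥(Dᶜ) => f ↑x) {x : X}
    (hx : x ∉ D) : ∀ᶠ y in nhds x, y ∉ D → f y = f x := by
  have h := hf.eventually_eq ⟨x, hx⟩
  rw [nhds_subtype_eq_comap, Filter.eventually_comap] at h
  filter_upwards [h] with y hy hyD
  exact hy ⟨y, hyD⟩ rfl

/-- A function that is locally constant off a discrete set `D` is constant off `D` on some
interval to the right of any given point. -/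
theorem IsLocallyConstant.exists_eq_on_Ioo {Y : Type*} {D : Set ℝ} (hD : DiscreteTopology D)
    {f : ℝ → Y} (hf : IsLocallyConstant fun x : ↥(Dᶜ) => f ↑x) (a : ℝ) :
    ∃ b > a, ∃ c : Y, ∀ x ∈ Set.Ioo a b, x ∉ D → f x = c := by
  by_cases ha : a ∈ D
  · have hev : ∀ᶠ y in nhdsWithin a (Set.Ioi a), y ∉ D := by
      obtain ⟨U, hU, hUD⟩ := disjoint_nhdsWithin_of_mem_discrete ⟨hD⟩ ha
      filter_upwards [nhdsWithin_mono a (fun y hy => ne_of_gt hy) hU] with y hy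
      exact Set.disjoint_left.1 hUD hy
    obtain ⟨b, hab, hb⟩ := (mem_nhdsGT_iff_exists_Ioo_subset).1 hev
    refine ⟨b, hab, f ((a + b) / 2), fun x hx _ => ?_⟩
    have hab' : a < b := hab
    have hcont : Continuous fun y : Set.Ioo a b => (⟨y, hb y.2⟩ : ↥(Dᶜ)) := by fun_prop
    have : PreconnectedSpace (Set.Ioo a b) := Subtype.preconnectedSpace isPreconnected_Ioo
    exact (hf.comp_continuous hcont).apply_eq_of_preconnectedSpace ⟨x, hx⟩
      ⟨(a + b) / 2, by constructor <;> linarith⟩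
  · have h := (hf.eventually_eq_of_notMem ha).filter_mono (nhdsWithin_le_nhds (s := Set.Ioi a))
    obtain ⟨b, hab, hb⟩ := (mem_nhdsGT_iff_exists_Ioo_subset).1 h
    exact ⟨b, hab, f a, fun x hx hxD => hb hx hxD⟩

theorem eq_apply_div_two_pow {Y : Type*} {f : ℝ → Y} {D : Set ℝ}
    (hD : ∀ x ∉ D, f x = f (2 * x)) {x : ℝ} (hx : ∀ n : ℕ, x / 2 ^ n ∉ D) (n : ℕ) :
    f x = f (x / 2 ^ n) := by
  induction n with
  | zero => simp
  | succ n ih =>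
    rw [ih, hD _ (hx (n + 1))]
    congr 1
    rw [pow_succ]
    field_simp

/-- A periodic, almost locally constant function `f : ℝ → ℝ` with
`f(x) = f(2x)` outside a discrete set is almost constant. -/
theorem almost_constant_of_periodic_doubling
    (f : ℝ → ℝ) (p : ℝ) (hp : 0 < p) (hper : Function.Periodic f p)
    (halc : AlmostLocallyConstant f)
    (hdbl : ∃ D : Set ℝ, DiscreteTopology D ∧ ∀ x ∉ D, f x = f (2 * x)) :
    AlmostConstant f := by
  obtain ⟨D, hD, hf⟩ := halc
  obtain ⟨D', hD', hdbl⟩ := hdbl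
  obtain ⟨b, hb, c, hc⟩ := hf.exists_eq_on_Ioo hD 0
  have hE := ((Set.Countable.of_discreteTopology hD).union
    (Set.Countable.of_discreteTopology hD')).preimage_add_mul_div_two_pow p
  set E : Set ℝ := {x : ℝ | ∃ n k : ℕ, (x + k * p) / 2 ^ n ∈ D ∪ D'}
  have hfc : ∀ x ∉ E, f x = c := by
    intro x hx
    have hx' : ∀ n k : ℕ, (x + k * p) / 2 ^ n ∉ D ∪ D' := fun n k h => hx ⟨n, k, h⟩
    obtain ⟨k, hk⟩ := exists_nat_gt (-x / p)
    rw [div_lt_iff₀ hp] at hk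
    obtain ⟨n, hn⟩ := pow_unbounded_of_one_lt ((x + k * p) / b) (one_lt_two (α := ℝ))
    have hpos : 0 < x + k * p := by linarith
    rw [← hper.nat_mul k x,
      eq_apply_div_two_pow hdbl (fun m h => hx' m k (Or.inr h)) n]
    refine hc _ ⟨by positivity, ?_⟩ fun h => hx' n k (Or.inl h)
    rw [div_lt_iff₀ hb] at hn
    rw [div_lt_iff₀ (by positivity)]
    linarith
  refine ⟨D, hD, c, fun x hx => ?_⟩
  obtain ⟨y, hy, hyE⟩ := mem_closure_iff_nhds.1
    (((Set.Countable.of_discreteTopology hD).union hE).dense_compl ℝ x) _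
    (hf.eventually_eq_of_notMem hx)
  rw [Set.mem_compl_iff, Set.mem_union, not_or] at hyE
  rw [← hy hyE.1, hfc y hyE.2]
end
end
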